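/- arXiv:1608.02817 — 2 statements merged into one kernel-verified Lean document; each statement's English description precedes it below -/
import Mathlib

section
/- Let m, n, and r be positive integers. Then ∑_{k=0}^{n-1} ((1-q^{2k+1})/(1-q^n)) D_q(m,k)^r D_{q^{-1}}(m,k)^r q^{-k} is a Laurent polynomial in q with non-negative integer coefficients. -/
open Finset

/-- The q-Pochhammer symbol `(a;q)_n = ∏_{j=0}^{n-1} (1 - a q^j)`. -/
noncomputable def qPoch {F : Type*} [Field F] (q a : F) (n : ℕ) : F :=
  ∏ j ∈ Finset.range n, (1 - a * q ^ j)

/-- The q-binomial coefficient `[n choose k]_q`, which is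
`(q;q)_n / ((q;q)_k (q;q)_{n-k})` for `0 ≤ k ≤ n` and `0` otherwise. -/
noncomputable def qBin {F : Type*} [Field F] (q : F) (n k : ℕ) : F :=
  if k ≤ n then qPoch q q n / (qPoch q q k * qPoch q q (n - k)) else 0

/-- The q-Delannoy number `D_q(m,n) = ∑_{k=0}^n q^{k(k-1)/2} [n,k]_q [n+m-k,n]_q`. -/
noncomputable def Dq {F : Type*} [Field F] (q : F) (m n : ℕ) : F :=
  ∑ k ∈ Finset.range (n + 1), q ^ (k * (k - 1) / 2) * qBin q n k * qBin q (n + m - k) n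

/-- The q-Delannoy number of the second kind
`D*_q(m,n) = ∑_{k=0}^n q^{k(k+1)/2} [n,k]_q [n+m-k,n]_q`. -/
noncomputable def Dstar {F : Type*} [Field F] (q : F) (m n : ℕ) : F :=
  ∑ k ∈ Finset.range (n + 1), q ^ (k * (k + 1) / 2) * qBin q n k * qBin q (n + m - k) n

/-- The field of rational functions `ℚ(q)`. -/
abbrev Fq : Type := FractionRing (Polynomial ℚ)

noncomputable def q : Fq := algebraMap (Polynomial ℚ) Fq Polynomial.X


section aux
variable {F : Type*} [Field F]

theorem ne1 {p : F} (hp : ∀ i : ℕ, 0 < i → p ^ i ≠ 1) (i : ℕ) (hi : 0 < i) : 1 - p ^ i ≠ 0 :=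
  fun h => hp i hi (by linear_combination -h)

theorem qPoch_succ (p : F) (n : ℕ) : qPoch p p (n + 1) = qPoch p p n * (1 - p ^ (n + 1)) := by
  unfold qPoch; rw [Finset.prod_range_succ]; ring

theorem qPoch_ne {p : F} (hp : ∀ i : ℕ, 0 < i → p ^ i ≠ 1) (n : ℕ) : qPoch p p n ≠ 0 := by
  induction n with
  | zero => simp [qPoch]
  | succ n ih => rw [qPoch_succ]; exact mul_ne_zero ih (ne1 hp _ (by omega))

theorem qBin_gt (p : F) {n k : ℕ} (h : n < k) : qBin p n k = 0 := by
  unfold qBin; rw [if_neg (by omega)]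

theorem qBin_zero {p : F} (hp : ∀ i : ℕ, 0 < i → p ^ i ≠ 1) (n : ℕ) : qBin p n 0 = 1 := by
  have := qPoch_ne hp n
  unfold qBin
  rw [if_pos (by omega)]
  have e : qPoch p p 0 = 1 := by simp [qPoch]
  simp only [Nat.sub_zero, Nat.sub_self, e, one_mul, mul_one]
  exact div_self this

theorem qBin_self {p : F} (hp : ∀ i : ℕ, 0 < i → p ^ i ≠ 1) (n : ℕ) : qBin p n n = 1 := by
  have := qPoch_ne hp n
  unfold qBin
  rw [if_pos (by omega)]
  have e : qPoch p p 0 = 1 := by simp [qPoch]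
  simp only [Nat.sub_zero, Nat.sub_self, e, one_mul, mul_one]
  exact div_self this

theorem qBin_add (p : F) (d k : ℕ) :
    qBin p (d + k) k = qPoch p p (d + k) / (qPoch p p k * qPoch p p d) := by
  unfold qBin; rw [if_pos (by omega)]; simp

theorem b1 {p : F} (hp : ∀ i : ℕ, 0 < i → p ^ i ≠ 1) (n k : ℕ) :
    qBin p (n + 1) (k + 1) * (1 - p ^ (k + 1)) = qBin p n k * (1 - p ^ (n + 1)) := by
  rcases lt_or_ge n k with h | h
  · rw [qBin_gt p h, qBin_gt p (by omega)]; ring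
  · obtain ⟨d, rfl⟩ := Nat.exists_eq_add_of_le' h
    rw [qBin_add, add_assoc, qBin_add, ← add_assoc, qPoch_succ, qPoch_succ]
    have h1 := qPoch_ne hp d
    have h2 := qPoch_ne hp k
    have h3 := ne1 hp (k + 1) (by omega)
    field_simp

theorem b4 {p : F} (hp : ∀ i : ℕ, 0 < i → p ^ i ≠ 1) (n k : ℕ) :
    qBin p (n + 1) k * (p ^ k - p ^ (n + 1)) = p ^ k * (1 - p ^ (n + 1)) * qBin p n k := by
  rcases lt_trichotomy (n + 1) k with h | h | h
  · rw [qBin_gt p h, qBin_gt p (by omega)]; ring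
  · subst h
    rw [qBin_gt p (show n < n + 1 by omega)]; ring
  · obtain ⟨d, rfl⟩ := Nat.exists_eq_add_of_le' (show k ≤ n by omega)
    rw [qBin_add, show d + k + 1 = (d + 1) + k by ring, qBin_add,
      show d + 1 + k = (d + k) + 1 by ring, qPoch_succ, qPoch_succ]
    have h1 := qPoch_ne hp d
    have h2 := qPoch_ne hp k
    have h3 := ne1 hp (d + 1) (by omega)
    field_simp
    ring

theorem b2 {p : F} (hp : ∀ i : ℕ, 0 < i → p ^ i ≠ 1) (n k : ℕ) :
    qBin p n (k + 1) * (p ^ k * (1 - p ^ (k + 1))) = qBin p n k * (p ^ k - p ^ n) := by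
  rcases lt_trichotomy n k with h | h | h
  · rw [qBin_gt p h, qBin_gt p (by omega)]; ring
  · subst h
    rw [qBin_gt p (show n < n + 1 by omega)]; ring
  · obtain ⟨d, rfl⟩ := Nat.exists_eq_add_of_le' (show k + 1 ≤ n by omega)
    rw [qBin_add, show d + (k + 1) = (d + 1) + k by ring, qBin_add,
      qPoch_succ, qPoch_succ]
    have h1 := qPoch_ne hp d
    have h2 := qPoch_ne hp k
    have h3 := ne1 hp (d + 1) (by omega)
    have h4 := ne1 hp (k + 1) (by omega)
    field_simp
    ring

theorem b3 {p : F} (hp : ∀ i : ℕ, 0 < i → p ^ i ≠ 1) (hp0 : p ≠ 0) (n k : ℕ) :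
    qBin p (n + 1) (k + 1) = qBin p n k + p ^ (k + 1) * qBin p n (k + 1) := by
  have h1 := b1 hp n k
  have h2 := b2 hp n k
  have h4 := ne1 hp (k + 1) (by omega)
  have h5 : p ^ k ≠ 0 := pow_ne_zero _ hp0
  apply mul_right_cancel₀ (mul_ne_zero h5 h4)
  linear_combination p ^ k * h1 - p ^ (k + 1) * h2

theorem b5 {p : F} (hp : ∀ i : ℕ, 0 < i → p ^ i ≠ 1) (n k : ℕ) :
    p ^ k * qBin p (n + 1) (k + 1) = p ^ n * qBin p n k + p ^ k * qBin p n (k + 1) := by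
  have h1 := b1 hp n k
  have h2 := b2 hp n k
  have h4 := ne1 hp (k + 1) (by omega)
  apply mul_right_cancel₀ h4
  linear_combination p ^ k * h1 - h2

theorem qBin_mem {p : F} (hp : ∀ i : ℕ, 0 < i → p ^ i ≠ 1) (hp0 : p ≠ 0) (L : Subsemiring F)
    (hL : p ∈ L) (n k : ℕ) : qBin p n k ∈ L := by
  induction n generalizing k with
  | zero =>
    cases k with
    | zero => rw [qBin_zero hp]; exact L.one_mem
    | succ k => rw [qBin_gt p (by omega)]; exact L.zero_mem
  | succ n ih =>
    cases k with
    | zero => rw [qBin_zero hp]; exact L.one_mem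
    | succ k =>
      rw [b3 hp hp0]
      exact L.add_mem (ih _) (L.mul_mem (pow_mem hL _) (ih _))

/-- Basis functions. -/
noncomputable def EE (p : F) (j k : ℕ) : F :=
  (p ^ (j * k))⁻¹ * qBin p (k + j) j * qBin p k j

theorem EE_zero {p : F} (hp : ∀ i : ℕ, 0 < i → p ^ i ≠ 1) (k : ℕ) : EE p 0 k = 1 := by
  simp [EE, qBin_zero hp]

theorem EE_gt (p : F) {j k : ℕ} (h : k < j) : EE p j k = 0 := by
  simp [EE, qBin_gt p h]

theorem EE_succ {p : F} (hp : ∀ i : ℕ, 0 < i → p ^ i ≠ 1) (hp0 : p ≠ 0) (j k : ℕ) :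
    EE p (j + 1) k * (1 - p ^ (j + 1)) ^ 2 =
      EE p j k * ((p ^ k)⁻¹ + p ^ (k + 1) - p ^ (j + 1) - (p ^ j)⁻¹) := by
  unfold EE
  have h1 := b1 hp (k + j) j
  have h2 := b2 hp k j
  have h5 : p ^ k ≠ 0 := pow_ne_zero _ hp0
  have h6 : p ^ j ≠ 0 := pow_ne_zero _ hp0
  have h7 : p ^ (j * k) ≠ 0 := pow_ne_zero _ hp0
  rw [← add_assoc, show (j + 1) * k = j * k + k by ring, pow_add p (j * k)]
  have e : (p ^ k)⁻¹ + p ^ (k + 1) - p ^ (j + 1) - (p ^ j)⁻¹ =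
    (p ^ k)⁻¹ * (p ^ j)⁻¹ * ((1 - p ^ (k + j + 1)) * (p ^ j - p ^ k)) := by
    field_simp; ring
  rw [e]
  have : ((p ^ (j * k))⁻¹ * (p ^ k)⁻¹ * (p ^ j)⁻¹) * ((qBin p (k + j + 1) (j + 1) * (1 - p ^ (j + 1))) * 
     (qBin p k (j + 1) * (p ^ j * (1 - p ^ (j + 1))))) = 
     ((p ^ (j * k))⁻¹ * (p ^ k)⁻¹ * (p ^ j)⁻¹) * ((qBin p (k + j) j * (1 - p ^ (k + j + 1))) * (qBin p k j * (p ^ j - p ^ k))) := by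
    rw [h1, h2]
  rw [mul_inv]
  have e2 : p ^ j * (p ^ j)⁻¹ = 1 := mul_inv_cancel₀ h6
  linear_combination this - ((p ^ (j * k))⁻¹ * (p ^ k)⁻¹) * ((qBin p (k + j + 1) (j + 1) * (1 - p ^ (j + 1))) * 
     (qBin p k (j + 1) * ((1 - p ^ (j + 1))))) * e2

/-- Value of the telescoping sum. -/
noncomputable def WW (p : F) (j n : ℕ) : F :=
  p ^ (j + 1) * (p ^ ((j + 1) * n))⁻¹ * qBin p (n + j) j * qBin p n (j + 1)

theorem WW_step {p : F} (hp : ∀ i : ℕ, 0 < i → p ^ i ≠ 1) (hp0 : p ≠ 0) (j n : ℕ) :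
    (1 - p ^ (n + 1)) * WW p j (n + 1) - (1 - p ^ n) * WW p j n =
      (1 - p ^ (2 * n + 1)) * (p ^ n)⁻¹ * EE p j n := by
  unfold EE WW
  have h1 := b1 hp n j
  have h2 := b2 hp n j
  have h3 := b4 hp (n + j) j
  have h4 := ne1 hp (j + 1) (by omega)
  have h4' := ne1 hp (n + 1) (by omega)
  have h5 : p ^ n ≠ 0 := pow_ne_zero _ hp0
  have h6 : p ^ j ≠ 0 := pow_ne_zero _ hp0
  have h7 : p ^ (j * n) ≠ 0 := pow_ne_zero _ hp0
  have g1 : qBin p (n + 1) (j + 1) = qBin p n j * (1 - p ^ (n + 1)) / (1 - p ^ (j + 1)) := by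
    rw [eq_div_iff h4, h1]
  have g2 : qBin p n (j + 1) = qBin p n j * (p ^ j - p ^ n) / (p ^ j * (1 - p ^ (j + 1))) := by
    rw [eq_div_iff (mul_ne_zero h6 h4), h2]
  have g3 : qBin p (n + 1 + j) j = (1 - p ^ (n + j + 1)) * qBin p (n + j) j / (1 - p ^ (n + 1)) := by
    rw [eq_div_iff h4', show n + 1 + j = n + j + 1 by ring]
    apply mul_left_cancel₀ h6
    linear_combination h3
  rw [g1, g2, g3]
  rw [show (j + 1) * (n + 1) = j * n + n + j + 1 by ring, show (j + 1) * n = j * n + n by ring,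
    show 2 * n + 1 = n + n + 1 by ring]
  simp only [pow_add, pow_one] at *
  generalize p ^ (j * n) = a at *
  generalize p ^ n = N at *
  generalize p ^ j = J at *
  generalize qBin p n j = x at *
  generalize qBin p (n + j) j = y at *
  have k4 : 1 - p * J ≠ 0 := by rwa [mul_comm]
  have k4' : 1 - p * N ≠ 0 := by rwa [mul_comm]
  field_simp
  ring

theorem WW_sum {p : F} (hp : ∀ i : ℕ, 0 < i → p ^ i ≠ 1) (hp0 : p ≠ 0) (j n : ℕ) :
    ∑ k ∈ Finset.range n, (1 - p ^ (2 * k + 1)) * (p ^ k)⁻¹ * EE p j k = (1 - p ^ n) * WW p j n := by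
  induction n with
  | zero => simp
  | succ n ih => rw [Finset.sum_range_succ, ih, ← WW_step hp hp0]; ring


/-- Coefficients of the product formula. -/
noncomputable def UU (p : F) (m j : ℕ) : F :=
  p ^ (j * j) * (p ^ (j * m))⁻¹ * qBin p (m + j) (2 * j) *
    ∏ i ∈ Finset.range j, ((1 + p ^ i) * (1 + p ^ (i + 1)))

noncomputable def tt (p : F) (m j : ℕ) : F :=
  UU p m j * (p ^ j - p ^ m) * (1 + p * p ^ j) / (1 - p * p ^ j * p ^ j)

theorem UU_zero {p : F} (hp : ∀ i : ℕ, 0 < i → p ^ i ≠ 1) (m : ℕ) : UU p m 0 = 1 := by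
  simp [UU, qBin_zero hp]

theorem UU_gt (p : F) {m j : ℕ} (h : m < j) : UU p m j = 0 := by
  simp [UU, qBin_gt p (show m + j < 2 * j by omega)]

theorem UU_m {p : F} (hp : ∀ i : ℕ, 0 < i → p ^ i ≠ 1) (hp0 : p ≠ 0) (m j : ℕ) :
    (1 - p * p ^ m * p ^ j) * UU p m j = (p ^ j - p * p ^ m) * UU p (m + 1) j := by
  unfold UU
  have h3 := b4 hp (m + j) (2 * j)
  have h5 : p ^ m ≠ 0 := pow_ne_zero _ hp0
  have h6 : p ^ j ≠ 0 := pow_ne_zero _ hp0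
  have h7 : p ^ (j * m) ≠ 0 := pow_ne_zero _ hp0
  rw [show m + 1 + j = m + j + 1 by ring, show j * (m + 1) = j * m + j by ring]
  have h8 : qBin p (m + j + 1) (2 * j) * (p ^ j - p * p ^ m) =
      p ^ j * (1 - p * p ^ m * p ^ j) * qBin p (m + j) (2 * j) := by
    apply mul_left_cancel₀ h6
    linear_combination h3
  rw [pow_add p (j * m)]
  generalize qBin p (m + j) (2 * j) = x at *
  generalize qBin p (m + j + 1) (2 * j) = y at *
  generalize ∏ i ∈ Finset.range j, ((1 + p ^ i) * (1 + p ^ (i + 1))) = g at *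
  generalize p ^ (j * j) = a at *
  field_simp
  linear_combination -a * g * h8

theorem UU_j {p : F} (hp : ∀ i : ℕ, 0 < i → p ^ i ≠ 1) (hp0 : p ≠ 0) (m j : ℕ) :
    UU p m (j + 1) = UU p m j * p * p ^ j * (1 - p * p ^ m * p ^ j) * (p ^ j - p ^ m) *
      (1 + p ^ j) * (1 + p * p ^ j) /
      (p ^ m * (1 - p * p ^ j * p ^ j) * (1 - p ^ 2 * p ^ j * p ^ j)) := by
  unfold UU
  have h1 := b1 hp (m + j) (2 * j + 1)
  have h2 := b2 hp (m + j) (2 * j)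
  have h5 : p ^ m ≠ 0 := pow_ne_zero _ hp0
  have h6 : p ^ j ≠ 0 := pow_ne_zero _ hp0
  have h7 : p ^ (j * m) ≠ 0 := pow_ne_zero _ hp0
  have n1 : 1 - p * p ^ j * p ^ j ≠ 0 := by
    convert ne1 hp (2 * j + 1) (by omega) using 1; ring
  have n2 : 1 - p ^ 2 * p ^ j * p ^ j ≠ 0 := by
    convert ne1 hp (2 * j + 2) (by omega) using 1; ring
  rw [Finset.prod_range_succ]
  rw [show (j + 1) * m = j * m + m by ring, show (j + 1) * (j + 1) = j * j + j + j + 1 by ring,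
    show m + (j + 1) = m + j + 1 by ring, show 2 * (j + 1) = 2 * j + 1 + 1 by ring]
  have g1 : qBin p (m + j + 1) (2 * j + 1 + 1) =
      qBin p (m + j) (2 * j + 1) * (1 - p * p ^ m * p ^ j) / (1 - p ^ 2 * p ^ j * p ^ j) := by
    rw [eq_div_iff n2]; linear_combination h1
  have g2 : qBin p (m + j) (2 * j + 1) =
      qBin p (m + j) (2 * j) * (p ^ j - p ^ m) / (p ^ j * (1 - p * p ^ j * p ^ j)) := by
    rw [eq_div_iff (mul_ne_zero h6 n1)]
    apply mul_left_cancel₀ h6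
    linear_combination h2
  rw [g1, g2]
  simp only [pow_add, pow_one] at *
  generalize qBin p (m + j) (2 * j) = x at *
  generalize ∏ i ∈ Finset.range j, ((1 + p ^ i) * (1 + p ^ i * p)) = g at *
  generalize p ^ (j * j) = a at *
  generalize p ^ (j * m) = b at *
  generalize p ^ m = M at *
  generalize p ^ j = J at *
  field_simp

theorem rel1 {p : F} (hp : ∀ i : ℕ, 0 < i → p ^ i ≠ 1) (hp0 : p ≠ 0) (m j : ℕ) :
    tt p (m + 2) j - p * tt p m j =
      (1 + p ^ 2 * p ^ m) * UU p (m + 1) j + p * (1 + p ^ m) * UU p m j := by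
  have h1 := UU_m hp hp0 m j
  have h2 := UU_m hp hp0 (m + 1) j
  have n1 : 1 - p * p ^ j * p ^ j ≠ 0 := by
    convert ne1 hp (2 * j + 1) (by omega) using 1; ring
  have n3 : 1 - p * p ^ m * p ^ j ≠ 0 := by
    convert ne1 hp (m + j + 1) (by omega) using 1; ring
  have n4 : 1 - p ^ 2 * p ^ m * p ^ j ≠ 0 := by
    convert ne1 hp (m + j + 2) (by omega) using 1; ring
  unfold tt
  have e0 : UU p m j = (p ^ j - p * p ^ m) * UU p (m + 1) j / (1 - p * p ^ m * p ^ j) := by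
    rw [eq_div_iff n3]; linear_combination h1
  have e2 : UU p (m + 2) j * (p ^ j - p ^ (m + 2)) =
      (1 - p ^ 2 * p ^ m * p ^ j) * UU p (m + 1) j := by
    linear_combination -h2
  rw [e2, e0]
  simp only [pow_add, pow_one] at *
  generalize UU p (m + 1) j = x at *
  generalize p ^ m = M at *
  generalize p ^ j = J at *
  have k1 : 1 - p * J ^ 2 ≠ 0 := by convert n1 using 1; ring
  field_simp
  ring

/-- Auxiliary. -/
noncomputable def hh (p : F) (m j : ℕ) : F :=
  (1 + p * p ^ m) * tt p (m + 2) j + (1 + p ^ 2 * p ^ m) * tt p (m + 1) j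

noncomputable def br (p : F) (m j : ℕ) : F :=
  (1 - p ^ 2 * p ^ m) ^ 2 * UU p (m + 2) j - p * (1 - p * p ^ m) ^ 2 * UU p m j
   - (1 - p) * (1 - p ^ 3 * (p ^ m) ^ 2) * UU p (m + 1) j
   + 2 * (1 + p ^ 2 * p ^ m) * tt p (m + 2) j + 2 * p * (1 + p * p ^ m) * tt p (m + 1) j
   - (p * p ^ j + (p ^ j)⁻¹) * hh p m j

theorem br_zero {p : F} (hp : ∀ i : ℕ, 0 < i → p ^ i ≠ 1) (m : ℕ) : br p m 0 = 0 := by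
  have n1 : 1 - p ≠ 0 := by
    convert ne1 hp 1 (by omega) using 1; ring
  simp only [br, hh, tt, UU_zero hp]
  simp only [pow_add, pow_one, pow_zero, mul_one, inv_one]
  generalize p ^ m = M at *
  field_simp
  ring

set_option maxHeartbeats 1000000 in
theorem br_succ {p : F} (hp : ∀ i : ℕ, 0 < i → p ^ i ≠ 1) (hp0 : p ≠ 0) (m j : ℕ) :
    br p m (j + 1) = (1 - p ^ (j + 1)) ^ 2 * hh p m j := by
  have h1 := UU_m hp hp0 m j
  have h2 := UU_m hp hp0 (m + 1) j
  have h5 : p ^ m ≠ 0 := pow_ne_zero _ hp0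
  have h6 : p ^ j ≠ 0 := pow_ne_zero _ hp0
  have n1 : 1 - p * p ^ j * p ^ j ≠ 0 := by
    convert ne1 hp (2 * j + 1) (by omega) using 1; ring
  have n2 : 1 - p ^ 2 * p ^ j * p ^ j ≠ 0 := by
    convert ne1 hp (2 * j + 2) (by omega) using 1; ring
  have n2' : 1 - p ^ 3 * p ^ j * p ^ j ≠ 0 := by
    convert ne1 hp (2 * j + 3) (by omega) using 1; ring
  have n3 : 1 - p * p ^ m * p ^ j ≠ 0 := by
    convert ne1 hp (m + j + 1) (by omega) using 1; ring
  have n4 : 1 - p ^ 2 * p ^ m * p ^ j ≠ 0 := by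
    convert ne1 hp (m + j + 2) (by omega) using 1; ring
  have e0 : UU p m j = (p ^ j - p * p ^ m) * UU p (m + 1) j / (1 - p * p ^ m * p ^ j) := by
    rw [eq_div_iff n3]; linear_combination h1
  have e1 : UU p (m + 1) j = (p ^ j - p ^ 2 * p ^ m) * UU p (m + 2) j / (1 - p ^ 2 * p ^ m * p ^ j) := by
    rw [eq_div_iff n4]; linear_combination h2
  have s2 := UU_j hp hp0 (m + 2) j
  have s1 := UU_j hp hp0 (m + 1) j
  have s0 := UU_j hp hp0 m j
  simp only [br, hh, tt]
  generalize UU p (m + 2) (j + 1) = V2 at *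
  generalize UU p (m + 1) (j + 1) = V1 at *
  generalize UU p m (j + 1) = V0 at *
  simp only [show p ^ (m + 2) = p ^ 2 * p ^ m by ring, show p ^ (m + 1) = p * p ^ m by ring,
    show p ^ (j + 1) = p * p ^ j by ring] at *
  generalize UU p (m + 2) j = U2 at *
  generalize UU p (m + 1) j = U1 at *
  generalize UU p m j = U0 at *
  generalize p ^ m = M at *
  generalize p ^ j = J at *
  obtain ⟨c, hc⟩ : ∃ c, U2 = c * (1 - p ^ 2 * M * J) * (1 - p * M * J) * (1 - p * J * J) *
      (1 - p ^ 2 * J * J) * (1 - p ^ 3 * J * J) * p ^ 2 * M * J :=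
    ⟨U2 / ((1 - p ^ 2 * M * J) * (1 - p * M * J) * (1 - p * J * J) *
      (1 - p ^ 2 * J * J) * (1 - p ^ 3 * J * J) * p ^ 2 * M * J), by
      have : (1 - p ^ 2 * M * J) * (1 - p * M * J) * (1 - p * J * J) *
        (1 - p ^ 2 * J * J) * (1 - p ^ 3 * J * J) * p ^ 2 * M * J ≠ 0 := by
        simp only [ne_eq, mul_eq_zero, not_or, pow_eq_zero_iff, OfNat.ofNat_ne_zero,
          not_false_eq_true]
        exact ⟨⟨⟨⟨⟨⟨⟨n4, n3⟩, n1⟩, n2⟩, n2'⟩, hp0⟩, h5⟩, h6⟩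
      have e := div_mul_cancel₀ U2 this
      simp only [← mul_assoc] at e ⊢
      exact e.symm⟩
  have f1 : U1 = (J - p ^ 2 * M) * c * (1 - p * M * J) * (1 - p * J * J) *
      (1 - p ^ 2 * J * J) * (1 - p ^ 3 * J * J) * p ^ 2 * M * J := by
    rw [e1, hc, div_eq_iff n4]; ring
  have f0 : U0 = (J - p ^ 2 * M) * (J - p * M) * c * (1 - p * J * J) *
      (1 - p ^ 2 * J * J) * (1 - p ^ 3 * J * J) * p ^ 2 * M * J := by
    rw [e0, f1, div_eq_iff n3]; ring
  have t2 : U2 * (J - p ^ 2 * M) * (1 + p * J) / (1 - p * J * J) =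
      c * (1 - p ^ 2 * M * J) * (1 - p * M * J) *
      (1 - p ^ 2 * J * J) * (1 - p ^ 3 * J * J) * p ^ 2 * M * J * (J - p ^ 2 * M) * (1 + p * J) := by
    rw [hc, div_eq_iff n1]; ring
  have t1 : U1 * (J - p * M) * (1 + p * J) / (1 - p * J * J) =
      (J - p ^ 2 * M) * c * (1 - p * M * J) *
      (1 - p ^ 2 * J * J) * (1 - p ^ 3 * J * J) * p ^ 2 * M * J * (J - p * M) * (1 + p * J) := by
    rw [f1, div_eq_iff n1]; ring
  have g2 : V2 = c * (1 - p ^ 2 * M * J) * (1 - p * M * J) * (1 - p ^ 3 * J * J) * J * p * J *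
      (1 - p ^ 3 * M * J) * (J - p ^ 2 * M) * (1 + J) * (1 + p * J) := by
    rw [s2, hc, div_eq_iff (mul_ne_zero (mul_ne_zero (mul_ne_zero (pow_ne_zero _ hp0) h5) n1) n2)]
    ring
  have g1 : V1 = c * (J - p ^ 2 * M) * (1 - p * M * J) * (1 - p ^ 3 * J * J) * p * J * p * J *
      (1 - p ^ 2 * M * J) * (J - p * M) * (1 + J) * (1 + p * J) := by
    rw [s1, f1, div_eq_iff (mul_ne_zero (mul_ne_zero (mul_ne_zero hp0 h5) n1) n2)]
    ring
  have g0 : V0 = c * (J - p ^ 2 * M) * (J - p * M) * (1 - p ^ 3 * J * J) * p ^ 2 * J * p * J *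
      (1 - p * M * J) * (J - M) * (1 + J) * (1 + p * J) := by
    rw [s0, f0, div_eq_iff (mul_ne_zero (mul_ne_zero h5 n1) n2)]
    ring
  have n5 : 1 - p * (p * J) * (p * J) ≠ 0 := by convert n2' using 1; ring
  have r2 : V2 * (p * J - p ^ 2 * M) * (1 + p * (p * J)) / (1 - p * (p * J) * (p * J)) =
      (p * J) * (c * (1 - p ^ 2 * M * J) * (1 - p * M * J) * J *
      (1 - p ^ 3 * M * J) * (J - p ^ 2 * M) * (1 + J) * (1 + p * J) *
      (p * J - p ^ 2 * M) * (1 + p * (p * J))) := by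
    rw [g2, div_eq_iff n5]; ring
  have r1 : V1 * (p * J - p * M) * (1 + p * (p * J)) / (1 - p * (p * J) * (p * J)) =
      (p * J) * (c * (J - p ^ 2 * M) * (1 - p * M * J) * p * J *
      (1 - p ^ 2 * M * J) * (J - p * M) * (1 + J) * (1 + p * J) *
      (p * J - p * M) * (1 + p * (p * J))) := by
    rw [g1, div_eq_iff n5]; ring
  rw [t2, t1, r2, r1, g2, g1, g0]
  have hk : p * J ≠ 0 := mul_ne_zero hp0 h6
  have hinv : ∀ a b x y : F, (a + (p * J)⁻¹) * (x * (p * J * b) + y * (p * J * b)) =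
     (a * (p * J) + 1) * (x * b + y * b) := by
    intro a b x y
    field_simp
  have hinv2 : ∀ a b b' x y : F, (a + (p * J)⁻¹) * (x * (p * J * b) + y * (p * J * b')) =
     (a * (p * J) + 1) * (x * b + y * b') := by
    intro a b b' x y
    field_simp
  rw [hinv2]
  ring

noncomputable def uS (p : F) (n m : ℕ) : F := ∑ j ∈ Finset.range (n + 1), UU p m j * EE p j n
noncomputable def tS (p : F) (n m : ℕ) : F := ∑ j ∈ Finset.range (n + 1), tt p m j * EE p j n

theorem relI {p : F} (hp : ∀ i : ℕ, 0 < i → p ^ i ≠ 1) (hp0 : p ≠ 0) (n m : ℕ) :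
    tS p n (m + 2) - p * tS p n m =
      (1 + p ^ 2 * p ^ m) * uS p n (m + 1) + p * (1 + p ^ m) * uS p n m := by
  unfold tS uS
  simp only [Finset.mul_sum, ← Finset.sum_sub_distrib, ← Finset.sum_add_distrib]
  apply Finset.sum_congr rfl
  intro j _
  linear_combination EE p j n * rel1 hp hp0 m j

theorem relII {p : F} (hp : ∀ i : ℕ, 0 < i → p ^ i ≠ 1) (hp0 : p ≠ 0) (n m : ℕ) :
    (1 - p ^ 2 * p ^ m) ^ 2 * uS p n (m + 2) - p * (1 - p * p ^ m) ^ 2 * uS p n m =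
      (1 - p) * (1 - p ^ 3 * (p ^ m) ^ 2) * uS p n (m + 1)
      + ((1 + p * p ^ m) * ((p ^ n)⁻¹ + p ^ (n + 1)) - 2 * (1 + p ^ 2 * p ^ m)) * tS p n (m + 2)
      + ((1 + p ^ 2 * p ^ m) * ((p ^ n)⁻¹ + p ^ (n + 1)) - 2 * p * (1 + p * p ^ m)) *
        tS p n (m + 1) := by
  have key : ∑ j ∈ Finset.range (n + 1),
      (br p m j * EE p j n - br p m (j + 1) * EE p (j + 1) n) = 0 := by
    rw [Finset.sum_range_sub' (fun j => br p m j * EE p j n)]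
    rw [br_zero hp, EE_gt p (show n < n + 1 by omega)]; ring
  rw [← sub_eq_zero, ← key]
  unfold tS uS
  simp only [Finset.mul_sum, ← Finset.sum_sub_distrib, ← Finset.sum_add_distrib]
  apply Finset.sum_congr rfl
  intro j _
  have h := EE_succ hp hp0 j n
  rw [br_succ hp hp0, br]
  simp only [hh]
  linear_combination ((1 + p * p ^ m) * tt p (m + 2) j + (1 + p ^ 2 * p ^ m) * tt p (m + 1) j) * h

theorem tt_zero {p : F} (hp : ∀ i : ℕ, 0 < i → p ^ i ≠ 1) (j : ℕ) : tt p 0 j = 0 := by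
  unfold tt
  cases j with
  | zero => simp
  | succ j => rw [UU_gt p (by omega)]; simp

theorem uS_zero {p : F} (hp : ∀ i : ℕ, 0 < i → p ^ i ≠ 1) (n : ℕ) : uS p n 0 = 1 := by
  unfold uS
  rw [Finset.sum_range_succ', UU_zero hp, EE_zero hp]
  rw [Finset.sum_eq_zero]
  · ring
  · intro j _; rw [UU_gt p (by omega)]; ring

theorem tS_zero {p : F} (hp : ∀ i : ℕ, 0 < i → p ^ i ≠ 1) (n : ℕ) : tS p n 0 = 0 := by
  unfold tS
  rw [Finset.sum_eq_zero]
  intro j _; rw [tt_zero hp]; ring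

theorem tS_one {p : F} (hp : ∀ i : ℕ, 0 < i → p ^ i ≠ 1) (n : ℕ) : tS p n 1 = 1 + p := by
  unfold tS
  rw [Finset.sum_range_succ', EE_zero hp]
  rw [Finset.sum_eq_zero]
  · have := ne1 hp 1 (by omega)
    simp only [pow_one] at this
    simp [tt, UU_zero hp]
    field_simp
  · intro j _
    unfold tt
    cases j with
    | zero => simp
    | succ j => rw [UU_gt p (by omega)]; ring

theorem uS_one {p : F} (hp : ∀ i : ℕ, 0 < i → p ^ i ≠ 1) (hp0 : p ≠ 0) (n : ℕ) :
    (1 - p) ^ 2 * uS p n 1 =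
      (1 - p) ^ 2 + 2 * (1 + p) * ((p ^ n)⁻¹ + p ^ (n + 1) - p - 1) := by
  have h := EE_succ hp hp0 0 n
  simp only [zero_add, pow_one, pow_zero, inv_one, EE_zero hp] at h
  have hU : UU p 1 1 = 2 * (1 + p) := by
    simp [UU, qBin_self hp]; field_simp; ring
  have : uS p n 1 = 1 + 2 * (1 + p) * EE p 1 n := by
    unfold uS
    rw [Finset.sum_range_succ', UU_zero hp, EE_zero hp]
    cases n with
    | zero => simp [EE_gt p (show 0 < 1 by omega)]
    | succ n =>
      rw [Finset.sum_range_succ', Finset.sum_eq_zero]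
      · rw [zero_add, zero_add, hU]; ring
      · intro j _; rw [UU_gt p (by omega)]; ring
  rw [this]
  linear_combination 2 * (1 + p) * h

theorem prod_formula {p : F} (hp : ∀ i : ℕ, 0 < i → p ^ i ≠ 1) (hp0 : p ≠ 0) (n : ℕ)
    (A B : ℕ → F) (hA0 : A 0 = 1) (hB0 : B 0 = 1)
    (hA1 : (1 - p) * A 1 = 2 - p ^ n * (1 + p))
    (hB1 : (1 - p) * B 1 = -(2 * p) + (1 + p) * (p ^ n)⁻¹)
    (hA : ∀ m, (1 - p ^ 2 * p ^ m) * A (m + 2) =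
      (1 + p * p ^ m - p ^ n * (1 + p ^ 2 * p ^ m)) * A (m + 1) + p ^ n * (1 - p * p ^ m) * A m)
    (hB : ∀ m, (1 - p ^ 2 * p ^ m) * B (m + 2) =
      (-(p + p ^ 2 * p ^ m) + (1 + p ^ 2 * p ^ m) * (p ^ n)⁻¹) * B (m + 1) +
        p * (p ^ n)⁻¹ * (1 - p * p ^ m) * B m) (m : ℕ) :
    A m * B m = uS p n m := by
  have hN : p ^ n * (p ^ n)⁻¹ = 1 := mul_inv_cancel₀ (pow_ne_zero _ hp0)
  have n1 := ne1 hp 1 (by omega)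
  rw [pow_one] at n1
  suffices H : A m * B m = uS p n m ∧ A (m + 1) * B (m + 1) = uS p n (m + 1) ∧
      (1 - p * p ^ m) * (A (m + 1) * B m) =
        (1 + p ^ m) * uS p n m + tS p n m - p ^ n * tS p n (m + 1) ∧
      (1 - p * p ^ m) * (A m * B (m + 1)) =
        -(p + p * p ^ m) * uS p n m - p * tS p n m + (p ^ n)⁻¹ * tS p n (m + 1) from H.1
  induction m with
  | zero =>
    simp only [zero_add, pow_zero, hA0, hB0, uS_zero hp, tS_zero hp, tS_one hp]
    refine ⟨by ring, ?_, by linear_combination hA1, by linear_combination hB1⟩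
    apply mul_left_cancel₀ (pow_ne_zero 2 n1)
    rw [uS_one hp hp0]
    rw [show (1 - p) ^ 2 * (A 1 * B 1) = ((1 - p) * A 1) * ((1 - p) * B 1) by ring, hA1, hB1]
    rw [pow_succ p n]
    linear_combination (-(1 + p) ^ 2) * hN
  | succ m ih =>
    obtain ⟨h0, h1, hv, hw⟩ := ih
    have hI := relI hp hp0 n m
    have hII := relII hp hp0 n m
    have n2 : 1 - p ^ 2 * p ^ m ≠ 0 := by
      convert ne1 hp (m + 2) (by omega) using 1; ring
    have hA' := hA m
    have hB' := hB m
    rw [show m + 1 + 1 = m + 2 by ring, show p ^ (m + 1) = p * p ^ m by ring]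
    rw [show p ^ (n + 1) = p * p ^ n by ring] at hII
    generalize p ^ m = K at *
    generalize (p ^ n)⁻¹ = I at *
    generalize p ^ n = N at *
    refine ⟨h1, ?_, ?_, ?_⟩
    · apply mul_left_cancel₀ (pow_ne_zero 2 n2)
      rw [show (1 - p ^ 2 * K) ^ 2 * (A (m + 2) * B (m + 2)) =
        ((1 - p ^ 2 * K) * A (m + 2)) * ((1 - p ^ 2 * K) * B (m + 2)) by ring, hA', hB']
      have e1 : ((1 + p * K - N * (1 + p ^ 2 * K)) * A (m + 1) + N * (1 - p * K) * A m) *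
          ((-(p + p ^ 2 * K) + (1 + p ^ 2 * K) * I) * B (m + 1) + p * I * (1 - p * K) * B m) =
          (1 + p * K - N * (1 + p ^ 2 * K)) * (-(p + p ^ 2 * K) + (1 + p ^ 2 * K) * I) *
            (A (m + 1) * B (m + 1)) +
          (1 + p * K - N * (1 + p ^ 2 * K)) * p * I * ((1 - p * K) * (A (m + 1) * B m)) +
          N * (-(p + p ^ 2 * K) + (1 + p ^ 2 * K) * I) * ((1 - p * K) * (A m * B (m + 1))) +
          N * I * p * (1 - p * K) ^ 2 * (A m * B m) := by ring
      rw [e1, h0, h1, hv, hw]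
      generalize uS p n m = u0 at *
      generalize uS p n (m + 1) = u1 at *
      generalize uS p n (m + 2) = u2 at *
      generalize tS p n m = t0 at *
      generalize tS p n (m + 1) = t1 at *
      generalize tS p n (m + 2) = t2 at *
      linear_combination -hII - ((1 + p * K) * (I + p * N) - 2 * (1 + p ^ 2 * K)) * hI +
        (-(1 + p ^ 2 * K) ^ 2 * u1 - (1 + p ^ 2 * K) * p * ((1 + K) * u0 + t0 - N * t1)
         - (1 + p * K) * p * t1 + (1 + p ^ 2 * K) * (-(p + p * K) * u0 - p * t0 + I * t1)
         - (p + p ^ 2 * K) * t1 + p * (1 - p * K) ^ 2 * u0) * hN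
    · linear_combination B (m + 1) * hA' + N * hw + (1 + p * K - N * (1 + p ^ 2 * K)) * h1 + tS p n (m + 1) * hN + N * hI
    · linear_combination A (m + 1) * hB' + p * I * hv + (-(p + p ^ 2 * K) + (1 + p ^ 2 * K) * I) * h1 - p * tS p n (m + 1) * hN - I * hI

theorem tri (k : ℕ) : (k + 1) * (k + 1 - 1) / 2 = k * (k - 1) / 2 + k := by
  rw [← Finset.sum_range_id_mul_two, ← Finset.sum_range_id_mul_two]
  simp [Finset.sum_range_succ]

open PowerSeries in
theorem Dq_rec {p : F} (hp : ∀ i : ℕ, 0 < i → p ^ i ≠ 1) (hp0 : p ≠ 0) (n : ℕ) :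
    Dq p 0 n = 1 ∧ (1 - p) * Dq p 1 n = 2 - p ^ n * (1 + p) ∧
    ∀ m, (1 - p ^ 2 * p ^ m) * Dq p (m + 2) n =
      (1 + p * p ^ m - p ^ n * (1 + p ^ 2 * p ^ m)) * Dq p (m + 1) n
        + p ^ n * (1 - p * p ^ m) * Dq p m n := by
  set e : F⟦X⟧ := PowerSeries.mk fun k => p ^ (k * (k - 1) / 2) * qBin p n k with he
  set h : F⟦X⟧ := PowerSeries.mk fun k => qBin p (n + k) n with hh
  have hD : ∀ m, Dq p m n = coeff m (e * h) := by
    intro m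
    rw [coeff_mul, Finset.Nat.sum_antidiagonal_eq_sum_range_succ_mk]
    simp only [he, hh, coeff_mk]
    unfold Dq
    have l1 : ∑ k ∈ Finset.range (n + 1), p ^ (k * (k - 1) / 2) * qBin p n k * qBin p (n + m - k) n
      = ∑ k ∈ Finset.range (n + m + 1), p ^ (k * (k - 1) / 2) * qBin p n k * qBin p (n + m - k) n := by
      apply Finset.sum_subset
      · intro x; simp; omega
      · intro x _ hx
        simp at hx
        rw [qBin_gt p (show n < x by omega)]; ring
    rw [l1]
    symm
    have l2 : ∑ k ∈ Finset.range (m + 1), p ^ (k * (k - 1) / 2) * qBin p n k * qBin p (n + m - k) n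
      = ∑ k ∈ Finset.range (n + m + 1), p ^ (k * (k - 1) / 2) * qBin p n k * qBin p (n + m - k) n := by
      apply Finset.sum_subset
      · intro x; simp; omega
      · intro x hx' hx
        simp at hx hx'
        by_cases hn : n = 0
        · rw [qBin_gt p (show n < x by omega)]; ring
        · rw [qBin_gt p (show n + m - x < n by omega)]; ring
    rw [← l2]
    apply Finset.sum_congr rfl
    intro x hx
    simp at hx
    rw [show n + (m - x) = n + m - x by omega]
  have fe : (1 + C (p ^ n) * X) * e = (1 + X) * rescale p e := by
    ext k
    rw [add_mul, add_mul, one_mul, one_mul, mul_assoc, map_add, map_add, coeff_C_mul]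
    cases k with
    | zero => simp [coeff_zero_X_mul]
    | succ k =>
      rw [coeff_succ_X_mul, coeff_succ_X_mul, coeff_rescale, coeff_rescale]
      simp only [he, coeff_mk]
      rw [tri, pow_add]
      have := b2 hp n k
      linear_combination p ^ (k * (k - 1) / 2) * this
  have fh : (1 - X) * h = (1 - C (p ^ (n + 1)) * X) * rescale p h := by
    ext k
    rw [sub_mul, sub_mul, one_mul, one_mul, mul_assoc, map_sub, map_sub, coeff_C_mul]
    cases k with
    | zero => simp [coeff_zero_X_mul]
    | succ k =>
      rw [coeff_succ_X_mul, coeff_succ_X_mul, coeff_rescale, coeff_rescale]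
      simp only [hh, coeff_mk]
      have := b4 hp (n + k) n
      have h6 : p ^ n ≠ 0 := pow_ne_zero _ hp0
      rw [← add_assoc]
      apply mul_left_cancel₀ h6
      linear_combination this
  have ff : (1 - X) * ((1 + C (p ^ n) * X) * (e * h)) =
      (1 - C (p ^ (n + 1)) * X) * ((1 + X) * rescale p (e * h)) := by
    rw [map_mul]
    linear_combination ((1 - X) * h) * fe + (1 + X) * rescale p e * fh
  have ff' : (e * h) + C (p ^ n - 1) * (X * (e * h)) - C (p ^ n) * (X * (X * (e * h))) =
      rescale p (e * h) + C (1 - p ^ (n + 1)) * (X * rescale p (e * h))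
        - C (p ^ (n + 1)) * (X * (X * rescale p (e * h))) := by
    simp only [map_sub, map_one]
    linear_combination ff
  have z : Dq p 0 n = 1 := by
    rw [hD]; simp [coeff_mul, he, hh, qBin_zero hp, qBin_self hp]
  obtain ⟨c1, hc1⟩ : ∃ c, c = p ^ n - 1 := ⟨_, rfl⟩
  obtain ⟨c2, hc2⟩ : ∃ c, c = 1 - p ^ (n + 1) := ⟨_, rfl⟩
  rw [← hc1, ← hc2] at ff'
  refine ⟨z, ?_, ?_⟩
  · have := congrArg (coeff 1) ff'
    have k1 : ∀ f : F⟦X⟧, coeff 1 (X * f) = coeff 0 f := fun f => coeff_succ_X_mul 0 f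
    rw [map_sub, map_sub, map_add, map_add, coeff_C_mul, coeff_C_mul, coeff_C_mul, coeff_C_mul,
      k1, k1, k1, k1, coeff_zero_X_mul, coeff_zero_X_mul, coeff_rescale, coeff_rescale,
      ← hD, ← hD, z, hc1, hc2] at this
    linear_combination this
  · intro m
    have := congrArg (coeff (m + 1 + 1)) ff'
    simp only [map_add, map_sub, coeff_C_mul, coeff_rescale, coeff_succ_X_mul, ← hD] at this
    rw [hc1, hc2] at this
    linear_combination this

theorem Dq_prod {p : F} (hp : ∀ i : ℕ, 0 < i → p ^ i ≠ 1) (hp0 : p ≠ 0) (m n : ℕ) :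
    Dq p m n * Dq p⁻¹ m n = uS p n m := by
  obtain ⟨a0, a1, a2⟩ := Dq_rec hp hp0 n
  have hp' : ∀ i : ℕ, 0 < i → p⁻¹ ^ i ≠ 1 := by
    intro i hi h
    rw [inv_pow, inv_eq_one] at h
    exact hp i hi h
  obtain ⟨b0, b1, b2⟩ := Dq_rec hp' (inv_ne_zero hp0) n
  refine prod_formula hp hp0 n (fun m => Dq p m n) (fun m => Dq p⁻¹ m n) a0 b0 a1 ?_ a2 ?_ m
  · have hN : p ^ n ≠ 0 := pow_ne_zero _ hp0
    have e : p * p⁻¹ = 1 := mul_inv_cancel₀ hp0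
    rw [inv_pow] at b1
    linear_combination -p * b1 + (-(Dq p⁻¹ 1 n) + (p ^ n)⁻¹) * e
  · intro m
    have hN : p ^ n ≠ 0 := pow_ne_zero _ hp0
    have hM : p ^ m ≠ 0 := pow_ne_zero _ hp0
    have e : p * p⁻¹ = 1 := mul_inv_cancel₀ hp0
    have := b2 m
    generalize Dq p⁻¹ m n = x at *
    generalize Dq p⁻¹ (m + 1) n = y at *
    generalize Dq p⁻¹ (m + 2) n = z at *
    simp only [inv_pow] at this
    generalize p ^ n = N at *
    generalize p ^ m = M at *
    field_simp at this ⊢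
    linear_combination -this

/-- The cone spanned by the basis functions. -/
def Cone (p : F) (L : Subsemiring F) (f : ℕ → F) : Prop :=
  ∃ (J : ℕ) (c : ℕ → F), (∀ j, c j ∈ L) ∧ ∀ k, f k = ∑ j ∈ Finset.range J, c j * EE p j k

theorem Cone.single {p : F} {L : Subsemiring F} {a : F} (ha : a ∈ L) (j : ℕ) :
    Cone p L (fun k => a * EE p j k) := by
  refine ⟨j + 1, fun i => if i = j then a else 0, ?_, ?_⟩
  · intro i; dsimp only; split_ifs
    · exact ha
    · exact L.zero_mem
  · intro k
    simp [Finset.sum_ite_eq', ite_mul]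

theorem Cone.extend {p : F} {L : Subsemiring F} {f : ℕ → F} (hf : Cone p L f) :
    ∃ J₀ : ℕ, ∀ J, J₀ ≤ J → ∃ c : ℕ → F, (∀ j, c j ∈ L) ∧
      ∀ k, f k = ∑ j ∈ Finset.range J, c j * EE p j k := by
  obtain ⟨J, c, hc, h⟩ := hf
  refine ⟨J, fun J' hJ => ⟨fun j => if j < J then c j else 0, ?_, ?_⟩⟩
  · intro i; dsimp only; split_ifs
    · exact hc i
    · exact L.zero_mem
  · intro k
    rw [h k]
    have : ∑ j ∈ Finset.range J, c j * EE p j k =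
        ∑ j ∈ Finset.range J, (if j < J then c j else 0) * EE p j k := by
      apply Finset.sum_congr rfl
      intro j hj; rw [if_pos (Finset.mem_range.1 hj)]
    rw [this]
    apply Finset.sum_subset
    · intro x; simp; omega
    · intro x _ hx
      rw [if_neg (by simpa using hx)]; ring

theorem Cone.add {p : F} {L : Subsemiring F} {f g : ℕ → F} (hf : Cone p L f) (hg : Cone p L g) :
    Cone p L (fun k => f k + g k) := by
  obtain ⟨J1, h1⟩ := hf.extend
  obtain ⟨J2, h2⟩ := hg.extend
  obtain ⟨c, hc, h⟩ := h1 (max J1 J2) (le_max_left _ _)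
  obtain ⟨c', hc', h'⟩ := h2 (max J1 J2) (le_max_right _ _)
  refine ⟨max J1 J2, fun j => c j + c' j, fun j => L.add_mem (hc j) (hc' j), fun k => ?_⟩
  dsimp only
  rw [h, h', ← Finset.sum_add_distrib]
  apply Finset.sum_congr rfl
  intros; ring

theorem Cone.sum {p : F} {L : Subsemiring F} {f : ℕ → ℕ → F} (hf : ∀ i, Cone p L (f i)) (n : ℕ) :
    Cone p L (fun k => ∑ i ∈ Finset.range n, f i k) := by
  induction n with
  | zero => exact ⟨0, fun _ => 0, fun _ => L.zero_mem, by simp⟩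
  | succ n ih =>
    simp only [Finset.sum_range_succ]
    exact ih.add (hf n)

theorem Cone.smul {p : F} {L : Subsemiring F} {f : ℕ → F} (hf : Cone p L f) {a : F} (ha : a ∈ L) :
    Cone p L (fun k => a * f k) := by
  obtain ⟨J, c, hc, h⟩ := hf
  refine ⟨J, fun j => a * c j, fun j => L.mul_mem ha (hc j), fun k => ?_⟩
  dsimp only
  rw [h, Finset.mul_sum]
  apply Finset.sum_congr rfl
  intros; ring

/-- Structure constants. -/
noncomputable def SC (p : F) (i j s : ℕ) : F :=
  (p ^ ((j + s) * (i - s)))⁻¹ * qBin p i s * qBin p (i + j) i * qBin p (j + s) i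

theorem SC_gt (p : F) {i j s : ℕ} (h : i < s) : SC p i j s = 0 := by
  simp [SC, qBin_gt p h]

theorem lin_aux {p : F} (hp : ∀ i : ℕ, 0 < i → p ^ i ≠ 1) (hp0 : p ≠ 0) (j i l : ℕ) :
    EE p l j * (((p ^ j)⁻¹ + p ^ (j + 1)) - p ^ (i + 1) - (p ^ i)⁻¹) =
    EE p (l + 1) j * (1 - p ^ (l + 1)) ^ 2 +
      (p ^ l)⁻¹ * (p ^ i)⁻¹ * (p ^ i - p ^ l) * (1 - p ^ (l + i + 1)) * EE p l j := by
  have h := EE_succ hp hp0 l j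
  have h5 : p ^ i ≠ 0 := pow_ne_zero _ hp0
  have h6 : p ^ l ≠ 0 := pow_ne_zero _ hp0
  have e : (p ^ l)⁻¹ * (p ^ i)⁻¹ * (p ^ i - p ^ l) * (1 - p ^ (l + i + 1)) =
     (p ^ l)⁻¹ + p ^ (l + 1) - p ^ (i + 1) - (p ^ i)⁻¹ := by
    field_simp; ring
  rw [e]
  linear_combination -h

theorem SC_zero_step {p : F} (hp : ∀ i : ℕ, 0 < i → p ^ i ≠ 1) (hp0 : p ≠ 0) (i j : ℕ) :
    SC p (i + 1) j 0 * (1 - p ^ (i + 1)) ^ 2 =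
      SC p i j 0 * ((p ^ j)⁻¹ * (p ^ i)⁻¹ * (p ^ i - p ^ j) * (1 - p ^ (j + i + 1))) := by
  unfold SC
  have h1 := b1 hp (i + j) i
  have h2 := b2 hp j i
  have h5 : p ^ i ≠ 0 := pow_ne_zero _ hp0
  rw [qBin_zero hp, qBin_zero hp]
  simp only [Nat.sub_zero, add_zero]
  rw [show j * (i + 1) = j * i + j by ring, pow_add p (j * i) j, mul_inv, show i + 1 + j = i + j + 1 by ring,
    show j + i + 1 = i + j + 1 by ring]
  have e2 : p ^ i * (p ^ i)⁻¹ = 1 := mul_inv_cancel₀ h5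
  have h2' : qBin p j (i + 1) * (1 - p ^ (i + 1)) = (p ^ i)⁻¹ * (qBin p j i * (p ^ i - p ^ j)) := by
    rw [← h2]; field_simp
  calc _ = (p ^ (j * i))⁻¹ * (p ^ j)⁻¹ * (qBin p (i + j + 1) (i + 1) * (1 - p ^ (i + 1))) *
        (qBin p j (i + 1) * (1 - p ^ (i + 1))) := by ring
    _ = _ := by rw [h1, h2']; ring

theorem SC_step {p : F} (hp : ∀ i : ℕ, 0 < i → p ^ i ≠ 1) (hp0 : p ≠ 0) (i j s : ℕ) :
    SC p (i + 1) j (s + 1) * (1 - p ^ (i + 1)) ^ 2 =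
      SC p i j s * (1 - p ^ (j + s + 1)) ^ 2 +
      SC p i j (s + 1) * ((p ^ (j + s + 1))⁻¹ * (p ^ i)⁻¹ * (p ^ i - p ^ (j + s + 1)) *
        (1 - p ^ (j + s + 1 + i + 1))) := by
  rcases lt_or_ge i s with hs | hs
  · rw [SC_gt p hs, SC_gt p (show i < s + 1 by omega), SC_gt p (show i + 1 < s + 1 by omega)]; ring
  obtain ⟨d, rfl⟩ := Nat.exists_eq_add_of_le' hs
  set i := d + s with hi
  unfold SC
  have h1 := b1 hp (i + j) i
  have h3 := b4 hp (j + s) i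
  have h3' := b1 hp (j + s) i
  have h5 : p ^ i ≠ 0 := pow_ne_zero _ hp0
  have hs0 : p ^ s ≠ 0 := pow_ne_zero _ hp0
  have hP1 := b3 hp hp0 i s
  have hP2 := b5 hp i s
  -- exponents
  rw [show i + 1 - (s + 1) = d by omega, show i - s = d by omega,
    show i + 1 + j = i + j + 1 by ring, ← add_assoc j s 1]
  have k1 : qBin p (j + s + 1) i * (p ^ i)⁻¹ * (p ^ i - p ^ (j + s + 1)) =
      (1 - p ^ (j + s + 1)) * qBin p (j + s) i := by
    field_simp
    linear_combination h3
  have k0 : p ^ (j + s + 1) ≠ 0 := pow_ne_zero _ hp0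
  have k2 : (p ^ ((j + s) * d))⁻¹ = (p ^ ((j + s + 1) * d))⁻¹ * p ^ d := by
    have : p ^ d ≠ 0 := pow_ne_zero _ hp0
    rw [show (j + s + 1) * d = (j + s) * d + d by ring, pow_add, mul_inv]
    field_simp
  have k3 : (p ^ ((j + s + 1) * (i - (s + 1))))⁻¹ * qBin p i (s + 1) * (p ^ (j + s + 1))⁻¹ =
      (p ^ ((j + s + 1) * d))⁻¹ * qBin p i (s + 1) := by
    rcases Nat.eq_zero_or_pos d with h | h
    · rw [qBin_gt p (show i < s + 1 by omega)]; ring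
    · obtain ⟨d', rfl⟩ := Nat.exists_eq_add_of_lt h
      rw [show i - (s + 1) = d' by omega,
        show (j + s + 1) * (0 + d' + 1) = (j + s + 1) * d' + (j + s + 1) by ring, pow_add, mul_inv]
      ring
  have k4 : qBin p (i + 1) (s + 1) * (1 - p ^ (i + j + 1)) =
      p ^ d * qBin p i s * (1 - p ^ (j + s + 1)) +
      qBin p i (s + 1) * (1 - p ^ (j + s + 1 + i + 1)) := by
    have q2 : qBin p (i + 1) (s + 1) = p ^ d * qBin p i s + qBin p i (s + 1) := by
      apply mul_left_cancel₀ hs0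
      rw [hP2, hi]; ring
    have : qBin p (i + 1) (s + 1) * (1 - p ^ (i + j + 1)) =
      (p ^ d * qBin p i s + qBin p i (s + 1)) - 
        p ^ (i + j + 1) * (qBin p i s + p ^ (s + 1) * qBin p i (s + 1)) := by
      rw [← q2, ← hP1]; ring
    rw [this, hi]; ring
  calc _ = (p ^ ((j + s + 1) * d))⁻¹ * qBin p (i + 1) (s + 1) *
        (qBin p (i + j + 1) (i + 1) * (1 - p ^ (i + 1))) *
        (qBin p (j + s + 1) (i + 1) * (1 - p ^ (i + 1))) := by ring
    _ = (p ^ ((j + s + 1) * d))⁻¹ * (qBin p (i + 1) (s + 1) * (1 - p ^ (i + j + 1))) *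
        qBin p (i + j) i * (qBin p (j + s) i * (1 - p ^ (j + s + 1))) := by rw [h1, h3']; ring
    _ = (p ^ ((j + s + 1) * d))⁻¹ * p ^ d * qBin p i s * qBin p (i + j) i * qBin p (j + s) i *
          (1 - p ^ (j + s + 1)) ^ 2 +
        ((p ^ ((j + s + 1) * d))⁻¹ * qBin p i (s + 1)) * qBin p (i + j) i *
          ((1 - p ^ (j + s + 1)) * qBin p (j + s) i) * (1 - p ^ (j + s + 1 + i + 1)) := by
        rw [k4]; ring
    _ = _ := by rw [← k1, ← k3, k2]; ring

theorem EE_mul {p : F} (hp : ∀ i : ℕ, 0 < i → p ^ i ≠ 1) (hp0 : p ≠ 0) (i j k : ℕ) :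
    EE p i k * EE p j k = ∑ s ∈ Finset.range (i + 1), SC p i j s * EE p (j + s) k := by
  induction i with
  | zero =>
    simp [EE_zero hp, SC, qBin_zero hp]
  | succ i ih =>
    have n1 := ne1 hp (i + 1) (by omega)
    apply mul_right_cancel₀ (pow_ne_zero 2 n1)
    have h := EE_succ hp hp0 i k
    have : EE p (i + 1) k * EE p j k * (1 - p ^ (i + 1)) ^ 2 =
        (EE p i k * EE p j k) * ((p ^ k)⁻¹ + p ^ (k + 1) - p ^ (i + 1) - (p ^ i)⁻¹) := by
      linear_combination EE p j k * h
    rw [this, ih, Finset.sum_mul, Finset.sum_mul]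
    have l : ∀ s, SC p i j s * EE p (j + s) k * ((p ^ k)⁻¹ + p ^ (k + 1) - p ^ (i + 1) - (p ^ i)⁻¹) =
        SC p i j s * (1 - p ^ (j + s + 1)) ^ 2 * EE p (j + s + 1) k +
        SC p i j s * ((p ^ (j + s))⁻¹ * (p ^ i)⁻¹ * (p ^ i - p ^ (j + s)) *
        (1 - p ^ (j + s + i + 1))) * EE p (j + s) k := by
      intro s
      linear_combination SC p i j s * lin_aux hp hp0 k i (j + s)
    simp only [l]
    rw [Finset.sum_add_distrib]
    rw [Finset.sum_range_succ' (fun s => SC p (i + 1) j s * EE p (j + s) k * (1 - p ^ (i + 1)) ^ 2)]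
    have e1 : ∑ s ∈ Finset.range (i + 1), SC p i j s * ((p ^ (j + s))⁻¹ * (p ^ i)⁻¹ *
        (p ^ i - p ^ (j + s)) * (1 - p ^ (j + s + i + 1))) * EE p (j + s) k =
      ∑ s ∈ Finset.range (i + 1 + 1), SC p i j s * ((p ^ (j + s))⁻¹ * (p ^ i)⁻¹ *
        (p ^ i - p ^ (j + s)) * (1 - p ^ (j + s + i + 1))) * EE p (j + s) k := by
      rw [Finset.sum_range_succ _ (i + 1), SC_gt p (show i < i + 1 by omega)]; ring
    rw [e1, Finset.sum_range_succ' _ (i + 1), ← add_assoc, ← Finset.sum_add_distrib]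
    congr 1
    · apply Finset.sum_congr rfl
      intro s _
      have := SC_step hp hp0 i j s
      simp only [← add_assoc]
      linear_combination -EE p (j + s + 1) k * this
    · have := SC_zero_step hp hp0 i j
      simp only [add_zero]
      linear_combination -EE p j k * this

theorem SC_mem {p : F} (hp : ∀ i : ℕ, 0 < i → p ^ i ≠ 1) (hp0 : p ≠ 0) (L : Subsemiring F)
    (hL : p ∈ L) (hL' : p⁻¹ ∈ L) (i j s : ℕ) : SC p i j s ∈ L := by
  unfold SC
  rw [← inv_pow]
  exact L.mul_mem (L.mul_mem (L.mul_mem (pow_mem hL' _) (qBin_mem hp hp0 L hL _ _))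
    (qBin_mem hp hp0 L hL _ _)) (qBin_mem hp hp0 L hL _ _)

theorem UU_mem {p : F} (hp : ∀ i : ℕ, 0 < i → p ^ i ≠ 1) (hp0 : p ≠ 0) (L : Subsemiring F)
    (hL : p ∈ L) (hL' : p⁻¹ ∈ L) (m j : ℕ) : UU p m j ∈ L := by
  unfold UU
  rw [← inv_pow]
  refine L.mul_mem (L.mul_mem (L.mul_mem (pow_mem hL _) (pow_mem hL' _))
    (qBin_mem hp hp0 L hL _ _)) (L.prod_mem fun i _ => L.mul_mem ?_ ?_)
  · exact L.add_mem L.one_mem (pow_mem hL _)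
  · exact L.add_mem L.one_mem (pow_mem hL _)

theorem WW_mem {p : F} (hp : ∀ i : ℕ, 0 < i → p ^ i ≠ 1) (hp0 : p ≠ 0) (L : Subsemiring F)
    (hL : p ∈ L) (hL' : p⁻¹ ∈ L) (n j : ℕ) : WW p j n ∈ L := by
  unfold WW
  rw [← inv_pow]
  exact L.mul_mem (L.mul_mem (L.mul_mem (pow_mem hL _) (pow_mem hL' _))
    (qBin_mem hp hp0 L hL _ _)) (qBin_mem hp hp0 L hL _ _)

theorem Cone.mul {p : F} (hp : ∀ i : ℕ, 0 < i → p ^ i ≠ 1) (hp0 : p ≠ 0) {L : Subsemiring F}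
    (hL : p ∈ L) (hL' : p⁻¹ ∈ L) {f g : ℕ → F} (hf : Cone p L f) (hg : Cone p L g) :
    Cone p L (fun k => f k * g k) := by
  obtain ⟨J, c, hc, h⟩ := hf
  obtain ⟨J', c', hc', h'⟩ := hg
  have : (fun k => f k * g k) = fun k => ∑ i ∈ Finset.range J, ∑ j ∈ Finset.range J',
      ∑ s ∈ Finset.range (i + 1), (c i * c' j * SC p i j s) * EE p (j + s) k := by
    funext k
    rw [h, h', Finset.sum_mul_sum]
    apply Finset.sum_congr rfl; intro i _
    apply Finset.sum_congr rfl; intro j _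
    rw [show c i * EE p i k * (c' j * EE p j k) = c i * c' j * (EE p i k * EE p j k) by ring,
      EE_mul hp hp0, Finset.mul_sum]
    apply Finset.sum_congr rfl; intro s _
    ring
  rw [this]
  apply Cone.sum; intro i
  apply Cone.sum; intro j
  apply Cone.sum; intro s
  exact Cone.single (L.mul_mem (L.mul_mem (hc i) (hc' j)) (SC_mem hp hp0 L hL hL' i j s)) _

theorem Cone.Dq {p : F} (hp : ∀ i : ℕ, 0 < i → p ^ i ≠ 1) (hp0 : p ≠ 0) {L : Subsemiring F}
    (hL : p ∈ L) (hL' : p⁻¹ ∈ L) (m : ℕ) :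
    Cone p L (fun k => Dq p m k * Dq p⁻¹ m k) := by
  refine ⟨m + 1, fun j => UU p m j, UU_mem hp hp0 L hL hL' m, fun k => ?_⟩
  dsimp only
  rw [Dq_prod hp hp0, uS]
  have l1 : ∑ j ∈ Finset.range (k + 1), UU p m j * EE p j k =
      ∑ j ∈ Finset.range (k + m + 1), UU p m j * EE p j k := by
    apply Finset.sum_subset
    · intro x; simp; omega
    · intro x _ hx
      rw [EE_gt p (by simp at hx; omega)]; ring
  have l2 : ∑ j ∈ Finset.range (m + 1), UU p m j * EE p j k =
      ∑ j ∈ Finset.range (k + m + 1), UU p m j * EE p j k := by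
    apply Finset.sum_subset
    · intro x; simp; omega
    · intro x _ hx
      rw [UU_gt p (by simp at hx; omega)]; ring
  rw [l1, l2]

theorem Cone.pow {p : F} (hp : ∀ i : ℕ, 0 < i → p ^ i ≠ 1) (hp0 : p ≠ 0) {L : Subsemiring F}
    (hL : p ∈ L) (hL' : p⁻¹ ∈ L) {f : ℕ → F} (hf : Cone p L f) (r : ℕ) :
    Cone p L (fun k => f k ^ r) := by
  induction r with
  | zero =>
    have := Cone.single (p := p) L.one_mem 0
    simpa [EE_zero hp] using this
  | succ r ih =>
    simp only [pow_succ]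
    exact ih.mul hp hp0 hL hL' hf

theorem main_mem {p : F} (hp : ∀ i : ℕ, 0 < i → p ^ i ≠ 1) (hp0 : p ≠ 0) {L : Subsemiring F}
    (hL : p ∈ L) (hL' : p⁻¹ ∈ L) (m n r : ℕ) (hn : 0 < n) :
    ∑ k ∈ Finset.range n,
      (1 - p ^ (2 * k + 1)) / (1 - p ^ n) * Dq p m k ^ r * Dq p⁻¹ m k ^ r * (p ^ k)⁻¹ ∈ L := by
  obtain ⟨J, c, hc, h⟩ := (Cone.Dq hp hp0 hL hL' m).pow hp hp0 hL hL' r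
  have n1 := ne1 hp n hn
  have : ∑ k ∈ Finset.range n,
      (1 - p ^ (2 * k + 1)) / (1 - p ^ n) * Dq p m k ^ r * Dq p⁻¹ m k ^ r * (p ^ k)⁻¹ =
      ∑ j ∈ Finset.range J, c j * WW p j n := by
    have e : ∀ j, WW p j n = (1 - p ^ n)⁻¹ *
        ∑ k ∈ Finset.range n, (1 - p ^ (2 * k + 1)) * (p ^ k)⁻¹ * EE p j k := by
      intro j; rw [WW_sum hp hp0]; field_simp
    simp only [e, Finset.mul_sum]
    rw [Finset.sum_comm]
    apply Finset.sum_congr rfl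
    intro k _
    have hk := h k
    dsimp only at hk
    calc _ = (1 - p ^ (2 * k + 1)) * (1 - p ^ n)⁻¹ * (p ^ k)⁻¹ *
          (Dq p m k * Dq p⁻¹ m k) ^ r := by rw [mul_pow]; ring
      _ = _ := by
        rw [hk, Finset.mul_sum]
        apply Finset.sum_congr rfl
        intro j _; ring
  rw [this]
  exact L.sum_mem fun j _ => L.mul_mem (hc j) (WW_mem hp hp0 L hL hL' n j)

end aux

theorem q_ne_zero : q ≠ 0 := by
  unfold q
  rw [Ne, FaithfulSMul.algebraMap_eq_zero_iff]
  exact Polynomial.X_ne_zero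

theorem q_pow_ne_one (i : ℕ) (hi : 0 < i) : q ^ i ≠ 1 := by
  unfold q
  rw [← map_pow, ← map_one (algebraMap (Polynomial ℚ) Fq)]
  intro h
  have h2 := FaithfulSMul.algebraMap_injective (Polynomial ℚ) Fq h
  have := congrArg Polynomial.natDegree h2
  simp at this
  omega

theorem closure_form (x : Fq) (hx : x ∈ Subsemiring.closure ({q, q⁻¹} : Set Fq)) :
    ∃ f : ℤ →₀ ℕ, x = f.sum fun i b => (b : Fq) * q ^ i := by
  have key : x ∈ AddSubmonoid.closure {y : Fq | ∃ i : ℤ, y = q ^ i} := by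
    have hmul : ∀ a b : Fq, a ∈ AddSubmonoid.closure {y : Fq | ∃ i : ℤ, y = q ^ i} →
        b ∈ AddSubmonoid.closure {y : Fq | ∃ i : ℤ, y = q ^ i} →
        a * b ∈ AddSubmonoid.closure {y : Fq | ∃ i : ℤ, y = q ^ i} := by
      intro a b ha hb
      induction ha using AddSubmonoid.closure_induction with
      | mem a ha =>
        induction hb using AddSubmonoid.closure_induction with
        | mem b hb =>
          obtain ⟨i, rfl⟩ := ha
          obtain ⟨j, rfl⟩ := hb
          exact AddSubmonoid.subset_closure ⟨i + j, (zpow_add₀ q_ne_zero i j).symm⟩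
        | zero => simp
        | add u v _ _ hu hv => rw [mul_add]; exact add_mem hu hv
      | zero => simp
      | add u v _ _ hu hv => rw [add_mul]; exact add_mem hu hv
    induction hx using Subsemiring.closure_induction with
    | mem x hx =>
      rcases hx with rfl | rfl
      · exact AddSubmonoid.subset_closure ⟨1, by simp⟩
      · exact AddSubmonoid.subset_closure ⟨-1, by simp⟩
    | zero => exact zero_mem _
    | one => exact AddSubmonoid.subset_closure ⟨0, by simp⟩
    | add x y _ _ hx hy => exact add_mem hx hy
    | mul x y _ _ hx hy => exact hmul _ _ hx hy
  clear hx
  induction key using AddSubmonoid.closure_induction with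
  | mem x hx =>
    obtain ⟨i, rfl⟩ := hx
    exact ⟨Finsupp.single i 1, by simp⟩
  | zero => exact ⟨0, by simp⟩
  | add x y _ _ hx hy =>
    obtain ⟨f, rfl⟩ := hx
    obtain ⟨g, rfl⟩ := hy
    refine ⟨f + g, ?_⟩
    rw [Finsupp.sum_add_index']
    · simp
    · intros; push_cast; ring

theorem Dq_pow_sum_nonneg_coeffs (m n r : ℕ) (hm : 0 < m) (hn : 0 < n) (hr : 0 < r) :
    ∃ f : ℤ →₀ ℕ,
      ∑ k ∈ Finset.range n,
          (1 - q ^ (2 * k + 1)) / (1 - q ^ n) * Dq q m k ^ r * Dq q⁻¹ m k ^ r * (q ^ k)⁻¹ =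
      f.sum fun i b => (b : Fq) * q ^ i := by
  apply closure_form
  apply main_mem q_pow_ne_one q_ne_zero _ _ m n r hn
  · exact Subsemiring.subset_closure (by simp)
  · exact Subsemiring.subset_closure (by simp)
end

section
/- Let m, n, and r be positive integers. Then ∑_{k=0}^{n-1} (-1)^{n-k-1} ((1-q^{2k+1})/(1-q^n)) D_q(m,k)^r D_{q^{-1}}(m,k)^r q^{k(k-1)/2} is a Laurent polynomial in q with non-negative integer coefficients. -/
open Finset

namespace DQ

section gen
variable {F : Type*} [Field F]

lemma qPoch_succ (x a : F) (n : ℕ) : qPoch x a (n+1) = qPoch x a n * (1 - a * x^n) := by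
  simp [qPoch, Finset.prod_range_succ]

lemma qPoch_zero (x a : F) : qPoch x a 0 = 1 := by simp [qPoch]

lemma qP_ne (x : F) (h : ∀ j : ℕ, 0 < j → 1 - x^j ≠ 0) (n : ℕ) : qPoch x x n ≠ 0 := by
  rw [qPoch, Finset.prod_ne_zero_iff]
  intro j _
  have := h (j+1) (by omega)
  rwa [pow_succ'] at this

lemma qP_succ (x : F) (n : ℕ) : qPoch x x (n+1) = qPoch x x n * (1 - x^(n+1)) := by
  rw [qPoch_succ, pow_succ']

lemma qBin_succ_right (x : F) (h : ∀ j : ℕ, 0 < j → 1 - x^j ≠ 0) (n k : ℕ) :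
    (1 - x^(k+1)) * qBin x n (k+1) * x^k = (x^k - x^n) * qBin x n k := by
  unfold qBin
  rcases lt_trichotomy k n with hk | hk | hk
  · obtain ⟨d, rfl⟩ : ∃ d, n = k + 1 + d := ⟨n - (k+1), by omega⟩
    rw [if_pos (by omega), if_pos (by omega), show k + 1 + d - (k+1) = d by omega,
      show k + 1 + d - k = d + 1 by omega, qP_succ x k, qP_succ x d]
    have h1 := h (k+1) (by omega)
    have h2 := h (d+1) (by omega)
    have h3 := qP_ne x h k
    have h4 := qP_ne x h d
    field_simp
    ring
  · subst hk
    simp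
  · rw [if_neg (by omega), if_neg (by omega)]; simp

lemma qBin_succ_top (x : F) (h : ∀ j : ℕ, 0 < j → 1 - x^j ≠ 0) (n m : ℕ) :
    (1 - x^(m+1)) * qBin x (n+(m+1)) n = (1 - x^(m+1) * x^n) * qBin x (n+m) n := by
  unfold qBin
  rw [if_pos (by omega), if_pos (by omega), show n + (m+1) - n = m+1 by omega,
      show n + m - n = m by omega, ← add_assoc, qP_succ x m, qP_succ x (n+m)]
  have h1 := h (m+1) (by omega)
  have h3 := qP_ne x h n
  have h4 := qP_ne x h m
  field_simp
  ring

lemma tri_succ (k : ℕ) : (k+1) * (k+1-1) / 2 = k * (k-1) / 2 + k := by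
  rw [← Nat.choose_two_right, ← Nat.choose_two_right, Nat.choose_succ_succ' k 1]; simp; ring

open PowerSeries in
noncomputable def sA (x : F) (n : ℕ) : PowerSeries F := PowerSeries.mk fun k => x^(k*(k-1)/2) * qBin x n k
noncomputable def sB (x : F) (n : ℕ) : PowerSeries F := PowerSeries.mk fun k => qBin x (n+k) n

open PowerSeries in
lemma sA_eq (x : F) (h : ∀ j : ℕ, 0 < j → 1 - x^j ≠ 0) (n : ℕ) :
    (1 + (X : PowerSeries F)) * rescale x (sA x n) = (1 + X * C (x^n)) * sA x n := by
  ext k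
  rw [add_mul, add_mul, one_mul, one_mul, mul_assoc, map_add, map_add]
  cases k with
  | zero => simp [sA, coeff_rescale]
  | succ k =>
    rw [coeff_succ_X_mul, coeff_succ_X_mul, coeff_C_mul]
    simp only [coeff_rescale, sA, coeff_mk]
    rw [tri_succ, pow_add x (k*(k-1)/2)]
    have := qBin_succ_right x h n k
    linear_combination (-x^(k*(k-1)/2)) * this

open PowerSeries in
lemma sB_eq (x : F) (h : ∀ j : ℕ, 0 < j → 1 - x^j ≠ 0) (n : ℕ) :
    (1 - (X : PowerSeries F) * C (x * x^n)) * rescale x (sB x n) = (1 - X) * sB x n := by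
  ext k
  rw [sub_mul, sub_mul, one_mul, one_mul, mul_assoc, map_sub, map_sub]
  cases k with
  | zero => simp [sB, coeff_rescale]
  | succ k =>
    rw [coeff_succ_X_mul, coeff_succ_X_mul, coeff_C_mul]
    simp only [coeff_rescale, sB, coeff_mk]
    have := qBin_succ_top x h n k
    linear_combination (-1 : F) * this

open PowerSeries in
lemma coeff_sAB (x : F) (n m : ℕ) : coeff m (sA x n * sB x n) = Dq x m n := by
  rw [coeff_mul, Finset.Nat.sum_antidiagonal_eq_sum_range_succ_mk]
  unfold Dq
  simp only [sA, sB, coeff_mk]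
  trans ∑ k ∈ Finset.range (n + m + 1), x ^ (k * (k - 1) / 2) * qBin x n k * qBin x (n + m - k) n
  · have hs : Finset.range (m+1) ⊆ Finset.range (n+m+1) := by
      intro a; simp; omega
    rw [← Finset.sum_subset hs]
    · apply Finset.sum_congr rfl
      intro k hk
      rw [Finset.mem_range] at hk
      rw [show n + (m - k) = n + m - k by omega]
    · intro k hk hk'
      simp only [Finset.mem_range] at hk hk'
      by_cases hn : k ≤ n
      · have : qBin x (n+m-k) n = 0 := if_neg (by omega)
        rw [this, mul_zero]
      · have : qBin x n k = 0 := if_neg (by omega)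
        rw [this]; simp
  · have hs : Finset.range (n+1) ⊆ Finset.range (n+m+1) := by
      intro a; simp; omega
    rw [← Finset.sum_subset hs]
    intro k hk hk'
    simp only [Finset.mem_range] at hk hk'
    have : qBin x n k = 0 := if_neg (by omega)
    rw [this]; simp

open PowerSeries in
lemma Dq_rec (x : F) (h : ∀ j : ℕ, 0 < j → 1 - x^j ≠ 0) (n M : ℕ) :
    (1 - x^(M+1)) * Dq x (M+1) n = ((1 + x^M) - x^n * (1 + x * x^M)) * Dq x M n
      + x^n * (1 - x^M) * Dq x (M-1) n := by
  have key : (1 + (X : PowerSeries F)) * (1 - X * C (x * x^n)) * rescale x (sA x n * sB x n) =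
     (1 + X * C (x^n)) * (1 - X) * (sA x n * sB x n) := by
    rw [map_mul (rescale x)]
    linear_combination (1 - (X : PowerSeries F) * C (x * x^n)) * rescale x (sB x n) * sA_eq x h n
      + (1 + X * C (x^n)) * sA x n * sB_eq x h n
  set G := sA x n * sB x n with hG
  have key2 : rescale x G + X * (C (1 - x * x^n) * rescale x G - X * (C (x * x^n) * rescale x G))
     = G + X * (C (x^n - 1) * G - X * (C (x^n) * G)) := by
    simp only [map_sub, map_one] at key ⊢
    linear_combination key
  have := congrArg (coeff (M+1)) key2
  rw [map_add, map_add, coeff_succ_X_mul, coeff_succ_X_mul] at this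
  rw [map_sub (coeff M) (C (1 - x * x^n) * _), map_sub (coeff M) (C (x^n - 1) * _)] at this
  cases M with
  | zero =>
    simp [coeff_rescale, coeff_zero_X_mul, -map_sub] at this
    simp only [← coeff_zero_eq_constantCoeff_apply] at this
    rw [hG, coeff_sAB, coeff_sAB] at this
    simp
    linear_combination -this
  | succ M =>
    rw [coeff_succ_X_mul, coeff_succ_X_mul] at this
    simp only [coeff_C_mul, coeff_rescale, hG, coeff_sAB] at this
    simp only [Nat.add_sub_cancel]
    linear_combination -this

lemma Dq_zero (x : F) (h : ∀ j : ℕ, 0 < j → 1 - x^j ≠ 0) (n : ℕ) : Dq x 0 n = 1 := by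
  unfold Dq
  rw [Finset.sum_eq_single 0]
  · simp [qBin, qPoch_zero, qP_ne x h n]
  · intro k hk hk'
    simp only [Finset.mem_range] at hk
    have : qBin x (n+0-k) n = 0 := if_neg (by omega)
    rw [this, mul_zero]
  · simp

end gen
end DQ

namespace DQ
section gen2
variable {F : Type*} [Field F]

noncomputable def pp (x Z : F) (l : ℕ) : F :=
  ∏ i ∈ Finset.range l, ((1 - Z * (x^i)⁻¹) * (1 - Z * x^(i+1)))

lemma pp_zero (x Z : F) : pp x Z 0 = 1 := by simp [pp]

lemma pp_succ (x Z : F) (l : ℕ) :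
    pp x Z (l+1) = pp x Z l * ((1 - Z * (x^l)⁻¹) * (1 - Z * x^(l+1))) := by
  simp [pp, Finset.prod_range_succ]

lemma pp_up (x Z : F) (h0 : x ≠ 0) (l : ℕ) :
    pp x (Z * x) (l+1) = pp x Z l * ((1 - Z * x^(l+1)) * (1 - Z * x^(l+2))) := by
  induction l with
  | zero => simp only [pp_succ, pp_zero, pow_zero, inv_one, one_mul]; ring
  | succ l ih =>
    rw [pp_succ, ih, pp_succ x Z l]
    have : x^l ≠ 0 := pow_ne_zero _ h0
    simp only [pow_succ]
    field_simp
    try ring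

lemma pp_down (x Z : F) (h0 : x ≠ 0) (l : ℕ) :
    pp x (Z * x⁻¹) (l+1) = pp x Z l * ((1 - Z * (x^(l+1))⁻¹) * (1 - Z * (x^l)⁻¹)) := by
  induction l with
  | zero => simp only [pp_succ, pp_zero, pow_zero, inv_one, one_mul, zero_add, pow_one]; field_simp
  | succ l ih =>
    rw [pp_succ, ih, pp_succ x Z l]
    have : x^l ≠ 0 := pow_ne_zero _ h0
    simp only [pow_succ]
    field_simp

lemma pp_up' (x Z : F) (h0 : x ≠ 0) (l : ℕ) :
    pp x (Z * x) l * (1 - Z * x * (x^l)⁻¹) = pp x Z l * (1 - Z * x^(l+1)) := by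
  cases l with
  | zero => simp [pp_zero]
  | succ l =>
    rw [pp_up x Z h0, pp_succ]
    have : x^l ≠ 0 := pow_ne_zero _ h0
    simp only [pow_succ]
    field_simp

lemma pp_vanish (x : F) (h0 : x ≠ 0) (m l : ℕ) (hl : m < l) : pp x (x^m) l = 0 := by
  rw [pp, Finset.prod_eq_zero (Finset.mem_range.2 hl)]
  have : x^m ≠ 0 := pow_ne_zero _ h0
  field_simp
  simp

noncomputable def ww (x : F) (l : ℕ) : F :=
  ∏ i ∈ Finset.range l, (x * x^i * x^i * (1 + x^i) * (1 + x * x^i) /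
    ((1 - x * x^i * x^i) * (1 - x * x * x^i * x^i) * (1 - x * x^i)^2))

lemma ww_zero (x : F) : ww x 0 = 1 := by simp [ww]

lemma ww_succ (x : F) (l : ℕ) : ww x (l+1) = ww x l * (x * x^l * x^l * (1 + x^l) * (1 + x * x^l) /
    ((1 - x * x^l * x^l) * (1 - x * x * x^l * x^l) * (1 - x * x^l)^2)) := by
  rw [ww, Finset.prod_range_succ]; rfl

noncomputable def BB (x Y Z : F) (l : ℕ) : F := ww x l * pp x Y l * pp x Z l / (Y^l * Z^l)

noncomputable def FF (x Y Z : F) (l : ℕ) : F := BB x Y Z l * ((x^l - Z) / (1 - x * x^l * x^l)) *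
  ((1 + x^l) - Y * (1 + x * x^l))

noncomputable def GG (x Y Z : F) (l : ℕ) : F := BB x Y Z l * ((x^l - Z) / (1 - x * x^l * x^l)) *
  ((1 + x * x^l) / Y - x * (1 + x^l))

lemma hne (x : F) (h : ∀ j : ℕ, 0 < j → 1 - x^j ≠ 0) (l : ℕ) :
    1 - x * x^l * x^l ≠ 0 ∧ 1 - x * x * x^l * x^l ≠ 0 ∧ 1 - x * x^l ≠ 0 := by
  refine ⟨?_, ?_, ?_⟩
  · have := h (2*l+1) (by omega); convert this using 2; ring
  · have := h (2*l+2) (by omega); convert this using 2; ring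
  · have := h (l+1) (by omega); convert this using 2; ring

lemma BB_up (x Y Z : F) (h0 : x ≠ 0) (hY : Y ≠ 0) (hZ : Z ≠ 0) (l : ℕ) :
    BB x Y (Z*x) l * (x^l - Z * x) = BB x Y Z l * (1 - Z * x * x^l) := by
  have := pp_up' x Z h0 l
  have hl : x^l ≠ 0 := pow_ne_zero _ h0
  have e : pp x (Z*x) l * (x^l - Z*x) = x^l * (pp x Z l * (1 - Z * x * x^l)) := by
    rw [show 1 - Z * x * x^l = 1 - Z * x^(l+1) by ring, ← this]
    field_simp
  unfold BB
  rw [mul_pow]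
  field_simp
  linear_combination ww x l * pp x Y l * e

lemma FF_step (x Y Z : F) (h : ∀ j : ℕ, 0 < j → 1 - x^j ≠ 0)
   (h0 : x ≠ 0) (hY : Y ≠ 0) (hZ : Z ≠ 0) (l : ℕ) :
    FF x Y (Z*x) l = ((1 + Z) - Y * (1 + x * Z)) * BB x Y Z l + Y * GG x Y Z l := by
  obtain ⟨h1, -, -⟩ := hne x h l
  have := BB_up x Y Z h0 hY hZ l
  have e : FF x Y (Z*x) l = BB x Y Z l * (1 - Z * x * x^l) / (1 - x * x^l * x^l) *
     ((1 + x^l) - Y * (1 + x * x^l)) := by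
    rw [← this]; unfold FF; ring
  rw [e]; unfold GG
  generalize BB x Y Z l = b
  generalize x^l = L at *
  have h1' : 1 - x * L^2 ≠ 0 := by convert h1 using 2; ring
  field_simp
  ring

lemma GG_step (x Y Z : F) (h : ∀ j : ℕ, 0 < j → 1 - x^j ≠ 0)
   (h0 : x ≠ 0) (hY : Y ≠ 0) (hZ : Z ≠ 0) (l : ℕ) :
    GG x Y (Z*x) l = ((1 + x * Z) / Y - x * (1 + Z)) * BB x Y Z l + x / Y * FF x Y Z l := by
  obtain ⟨h1, -, -⟩ := hne x h l
  have := BB_up x Y Z h0 hY hZ l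
  have e : GG x Y (Z*x) l = BB x Y Z l * (1 - Z * x * x^l) / (1 - x * x^l * x^l) *
     ((1 + x * x^l) / Y - x * (1 + x^l)) := by
    rw [← this]; unfold GG; ring
  rw [e]; unfold FF
  generalize BB x Y Z l = b
  generalize x^l = L at *
  have h1' : 1 - x * L^2 ≠ 0 := by convert h1 using 2; ring
  field_simp
  ring

/-- the summand of the quadratic recursion -/
noncomputable def RR (x Y Z : F) (l : ℕ) : F :=
  ((1 + Z) - Y * (1 + x * Z)) * ((1 + x * Z) / Y - x * (1 + Z)) * BB x Y Z l
  + ((1 + Z) - Y * (1 + x * Z)) * (x / Y) * FF x Y Z l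
  + ((1 + x * Z) / Y - x * (1 + Z)) * Y * GG x Y Z l
  + x * (1 - Z)^2 * BB x Y (Z * x⁻¹) l

noncomputable def TT (x Y Z : F) (l : ℕ) : F := BB x Y Z l *
  ((1+Z) * (1 + x * Z) + (x^l - Z) / (1 - x * x^l * x^l) *
    (x * (1 + Z) * (1 + x^l) + (1 + x * Z) * (1 + x * x^l))) *
  (1 / Y + x * Y - 1 / x^l - x * x^l)

lemma RR_zero (x Y Z : F) (h : ∀ j : ℕ, 0 < j → 1 - x^j ≠ 0)
   (h0 : x ≠ 0) (hY : Y ≠ 0) (hZ : Z ≠ 0) :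
    RR x Y Z 0 - (1 - Z * x)^2 * BB x Y (Z*x) 0 = TT x Y Z 0 := by
  obtain ⟨h1, -, -⟩ := hne x h 0
  simp only [RR, TT, FF, GG, BB, pp_zero, ww_zero, pow_zero, mul_one] at *
  field_simp
  ring

set_option maxHeartbeats 2000000 in
lemma RR_succ (x Y Z : F) (h : ∀ j : ℕ, 0 < j → 1 - x^j ≠ 0)
   (h0 : x ≠ 0) (hY : Y ≠ 0) (hZ : Z ≠ 0) (l : ℕ) :
    RR x Y Z (l+1) - (1 - Z * x)^2 * BB x Y (Z*x) (l+1) = TT x Y Z (l+1) - TT x Y Z l := by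
  obtain ⟨h1, h2, h3⟩ := hne x h l
  obtain ⟨h4, -, -⟩ := hne x h (l+1)
  have hl : x^l ≠ 0 := pow_ne_zero _ h0
  simp only [RR, TT, FF, GG, BB, pp_up x Z h0, pp_down x Z h0, pp_succ, ww_succ]
  simp only [mul_pow, pow_succ, inv_pow] at *
  generalize x^l = L at *
  generalize pp x Y l = p1
  generalize pp x Z l = p2
  generalize ww x l = w
  have hYl : Y^l ≠ 0 := pow_ne_zero _ hY
  have hZl : Z^l ≠ 0 := pow_ne_zero _ hZ
  generalize Y^l = Yl at *
  generalize Z^l = Zl at *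
  have h4' : 1 - x^3 * L^2 ≠ 0 := by convert h4 using 2; ring
  have h1' : 1 - x * L^2 ≠ 0 := by convert h1 using 2; ring
  have h2' : 1 - x^2 * L^2 ≠ 0 := by convert h2 using 2; ring
  field_simp
  ring

end gen2
end DQ

namespace DQ
section gen3
variable {F : Type*} [Field F]

lemma h_inv (x : F) (h : ∀ j : ℕ, 0 < j → 1 - x^j ≠ 0) (h0 : x ≠ 0) :
    ∀ j : ℕ, 0 < j → 1 - (x⁻¹)^j ≠ 0 := by
  intro j hj e
  apply h j hj
  have : (x⁻¹)^j = 1 := by linear_combination -e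
  rw [inv_pow, inv_eq_one] at this
  rw [this, sub_self]

lemma Dq_rec' (x : F) (h : ∀ j : ℕ, 0 < j → 1 - x^j ≠ 0) (h0 : x ≠ 0) (n M : ℕ) :
    (1 - x^(M+1)) * Dq x⁻¹ (M+1) n = ((1 + x * x^M) / x^n - x * (1 + x^M)) * Dq x⁻¹ M n
      + x / x^n * (1 - x^M) * Dq x⁻¹ (M-1) n := by
  have := Dq_rec x⁻¹ (h_inv x h h0) n M
  have h1 : x^M ≠ 0 := pow_ne_zero _ h0
  have h2 : x^n ≠ 0 := pow_ne_zero _ h0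
  simp only [pow_succ, inv_pow] at *
  generalize Dq x⁻¹ (M+1) n = a at *
  generalize Dq x⁻¹ M n = b at *
  generalize Dq x⁻¹ (M-1) n = c at *
  generalize x^M = L at *
  generalize x^n = Y at *
  field_simp at this ⊢
  linear_combination (-1 : F) * this

lemma sum_tel (f g t : ℕ → F) (N : ℕ) (h0 : f 0 - g 0 = t 0)
    (hs : ∀ l, f (l+1) - g (l+1) = t (l+1) - t l) :
    ∑ l ∈ range (N+1), f l - ∑ l ∈ range (N+1), g l = t N := by
  induction N with
  | zero => simpa using h0
  | succ N ih =>
    rw [Finset.sum_range_succ _ (N+1), Finset.sum_range_succ _ (N+1)]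
    linear_combination ih + hs N

lemma main_prod (x : F) (h : ∀ j : ℕ, 0 < j → 1 - x^j ≠ 0) (h0 : x ≠ 0) (n N M : ℕ) :
    M < N →
    Dq x M n * Dq x⁻¹ M n = ∑ l ∈ range N, BB x (x^n) (x^M) l ∧
    (1 - x^M)^2 * (Dq x (M-1) n * Dq x⁻¹ (M-1) n) =
      (1 - x^M)^2 * ∑ l ∈ range N, BB x (x^n) (x^M * x⁻¹) l ∧
    (1 - x^M) * (Dq x M n * Dq x⁻¹ (M-1) n) = ∑ l ∈ range N, FF x (x^n) (x^M) l ∧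
    (1 - x^M) * (Dq x (M-1) n * Dq x⁻¹ M n) = ∑ l ∈ range N, GG x (x^n) (x^M) l := by
  have hY : x^n ≠ 0 := pow_ne_zero _ h0
  induction M with
  | zero =>
    intro hN
    obtain ⟨N, rfl⟩ : ∃ k, N = k + 1 := ⟨N - 1, by omega⟩
    have hB : ∀ l, BB x (x^n) (x^0) (l+1) = 0 := by
      intro l; unfold BB; rw [pp_vanish x h0 0 (l+1) (by omega)]; simp
    rw [Dq_zero x h, Dq_zero _ (h_inv x h h0)]
    refine ⟨?_, by simp, ?_, ?_⟩
    · rw [Finset.sum_range_succ', Finset.sum_eq_zero (fun l _ => hB l)]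
      simp [BB, ww_zero, pp_zero]
    · rw [Finset.sum_range_succ', Finset.sum_eq_zero (fun l _ => by unfold FF; rw [hB l]; simp)]
      simp [FF]
    · rw [Finset.sum_range_succ', Finset.sum_eq_zero (fun l _ => by unfold GG; rw [hB l]; simp)]
      simp [GG]
  | succ M ih =>
    intro hN
    obtain ⟨i1, i2, i3, i4⟩ := ih (by omega)
    have hZ : x^M ≠ 0 := pow_ne_zero _ h0
    have r1 := Dq_rec x h n M
    have r2 := Dq_rec' x h h0 n M
    have hM := h (M+1) (by omega)
    simp only [Nat.add_sub_cancel]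
    refine ⟨?_, ?_, ?_, ?_⟩
    · apply mul_left_cancel₀ (pow_ne_zero 2 hM)
      obtain ⟨K, rfl⟩ : ∃ k, N = k + 1 := ⟨N - 1, by omega⟩
      have tel := sum_tel (RR x (x^n) (x^M)) (fun l => (1 - x^M * x)^2 * BB x (x^n) (x^M*x) l)
        (TT x (x^n) (x^M)) K (RR_zero x _ _ h h0 hY hZ) (RR_succ x _ _ h h0 hY hZ)
      have hT : TT x (x^n) (x^M) K = 0 := by
        unfold TT BB; rw [pp_vanish x h0 M K (by omega)]; simp
      rw [hT, ← Finset.mul_sum] at tel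
      unfold RR at tel
      simp only [Finset.sum_add_distrib, ← Finset.mul_sum] at tel
      rw [← i1, ← i3, ← i4] at tel
      rw [pow_succ x M] at *
      linear_combination tel + (1 - x^M*x) * Dq x⁻¹ (M+1) n * r1 + (((1 + x^M) - x^n * (1 + x * x^M)) * Dq x M n
      + x^n * (1 - x^M) * Dq x (M-1) n) * r2 + x * i2 +
        (x * (1-x^M)^2 * (Dq x (M-1) n * Dq x⁻¹ (M-1) n)) * mul_inv_cancel₀ hY
    · rw [pow_succ x M, mul_assoc (x^M), mul_inv_cancel₀ h0, mul_one, i1]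
    · rw [pow_succ, Finset.sum_congr rfl (fun l _ => FF_step x _ _ h h0 hY hZ l)]
      rw [Finset.sum_add_distrib, ← Finset.mul_sum, ← Finset.mul_sum, ← i1, ← i4]
      rw [pow_succ] at r1
      linear_combination Dq x⁻¹ M n * r1
    · rw [pow_succ, Finset.sum_congr rfl (fun l _ => GG_step x _ _ h h0 hY hZ l)]
      rw [Finset.sum_add_distrib, ← Finset.mul_sum, ← Finset.mul_sum, ← i1, ← i3]
      rw [pow_succ] at r2
      linear_combination Dq x M n * r2

noncomputable def ph (x Y : F) (l : ℕ) : F := pp x Y l / Y^l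

lemma ph_succ (x Y : F) (h0 : x ≠ 0) (hY : Y ≠ 0) (l : ℕ) :
    ph x Y (l+1) = ph x Y l * (1 / Y + x * Y - 1 / x^l - x * x^l) := by
  unfold ph
  rw [pp_succ]
  have : x^l ≠ 0 := pow_ne_zero _ h0
  simp only [pow_succ]
  field_simp
  ring

noncomputable def ee (x : F) (i s d : ℕ) : F :=
  (x^((i+s)*d))⁻¹ * (qPoch x x (s+d) / (qPoch x x s * qPoch x x d)) *
    (qPoch x x (i+s+d) / qPoch x x (i+s)) * ∏ a ∈ range d, (1 - x^i * (x^a)⁻¹)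

noncomputable def kk (x : F) (i s d : ℕ) : F :=
  1 / x^(i+s) + x * x^(i+s) - 1 / x^(s+d) - x * x^(s+d)

lemma ee_d0 (x : F) (h : ∀ j : ℕ, 0 < j → 1 - x^j ≠ 0) (i s : ℕ) : ee x i s 0 = 1 := by
  unfold ee
  simp [qPoch_zero, qP_ne x h]

lemma ee_zero (x : F) (h : ∀ j : ℕ, 0 < j → 1 - x^j ≠ 0) (h0 : x ≠ 0) (i d : ℕ) :
    ee x i 0 (d+1) = ee x i 0 d * kk x i 0 d := by
  have h1 := qP_ne x h d
  have h2 := qP_ne x h i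
  have h3 := h (d+1) (by omega)
  have hd : x^d ≠ 0 := pow_ne_zero _ h0
  have hi : x^i ≠ 0 := pow_ne_zero _ h0
  unfold ee kk
  simp only [Nat.add_zero, Nat.zero_add, qPoch_zero, ← add_assoc, qP_succ, Finset.prod_range_succ, mul_add, pow_add, pow_one, mul_one] at *
  have hid : x^(i*d) ≠ 0 := pow_ne_zero _ h0
  generalize ∏ a ∈ range d, (1 - x^i * (x^a)⁻¹) = pr
  field_simp
  ring

lemma ee_succ (x : F) (h : ∀ j : ℕ, 0 < j → 1 - x^j ≠ 0) (h0 : x ≠ 0) (i s d : ℕ) :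
    ee x i (s+1) (d+1) = ee x i s (d+1) + ee x i (s+1) d * kk x i (s+1) d := by
  have h1 := qP_ne x h d
  have h2 := qP_ne x h (i+s)
  have h2' := qP_ne x h s
  have h3 := h (d+1) (by omega)
  have h4 := h (s+1) (by omega)
  have h5 := h (i+s+1) (by omega)
  have hd : x^d ≠ 0 := pow_ne_zero _ h0
  have hs : x^s ≠ 0 := pow_ne_zero _ h0
  have hi : x^i ≠ 0 := pow_ne_zero _ h0
  unfold ee kk
  have e1 : s + 1 + d = s + d + 1 := by ring
  have e2 : i + s + 1 + d = i + s + d + 1 := by ring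
  simp only [← add_assoc, e1, e2, qP_succ, Finset.prod_range_succ, mul_add, add_mul, pow_add, pow_one, mul_one, one_mul] at *
  have hid : x^(i*d) ≠ 0 := pow_ne_zero _ h0
  have hsd : x^(s*d) ≠ 0 := pow_ne_zero _ h0
  generalize ∏ a ∈ range d, (1 - x^i * (x^a)⁻¹) = pr
  generalize x^(i*d) = t1 at *
  generalize x^(s*d) = t2 at *
  generalize x^i = xi at *
  generalize x^s = xs at *
  generalize x^d = xd at *
  generalize qPoch x x (s+d) = q1 at *
  generalize qPoch x x (i+s+d) = q2 at *
  field_simp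
  ring

lemma ph_mul (x Y : F) (h : ∀ j : ℕ, 0 < j → 1 - x^j ≠ 0) (h0 : x ≠ 0) (hY : Y ≠ 0) (i j : ℕ) :
    ph x Y i * ph x Y j = ∑ s ∈ range (j+1), ee x i s (j-s) * ph x Y (i+s) := by
  induction j with
  | zero => simp [ee_d0 x h, ph, pp_zero]
  | succ j ih =>
    rw [ph_succ x Y h0 hY, ← mul_assoc, ih, Finset.sum_mul]
    have e : ∀ s ∈ range (j+1), ee x i s (j-s) * ph x Y (i+s) * (1 / Y + x * Y - 1 / x^j - x * x^j)
       = ee x i s (j-s) * ph x Y (i+(s+1)) + ee x i s (j-s) * kk x i s (j-s) * ph x Y (i+s) := by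
      intro s hs
      rw [Finset.mem_range] at hs
      rw [← add_assoc, ph_succ x Y h0 hY, kk, show s + (j-s) = j by omega]
      ring
    rw [Finset.sum_congr rfl e, Finset.sum_add_distrib]
    rw [Finset.sum_range_succ (fun s => ee x i s (j-s) * ph x Y (i+(s+1))),
      Finset.sum_range_succ' (fun s => ee x i s (j-s) * kk x i s (j-s) * ph x Y (i+s)),
      Finset.sum_range_succ _ (j+1), Finset.sum_range_succ' _ j]
    have e2 : ∀ s ∈ range j, ee x i (s+1) (j+1-(s+1)) * ph x Y (i+(s+1)) =
        ee x i s (j-s) * ph x Y (i+(s+1)) + ee x i (s+1) (j-(s+1)) * kk x i (s+1) (j-(s+1)) * ph x Y (i+(s+1)) := by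
      intro s hs
      rw [Finset.mem_range] at hs
      obtain ⟨d, rfl⟩ : ∃ d, j = s + 1 + d := ⟨j - (s+1), by omega⟩
      rw [show s+1+d+1-(s+1) = d + 1 by omega, show s+1+d-s = d+1 by omega, show s+1+d-(s+1) = d by omega,
        ee_succ x h h0]
      ring
    rw [Finset.sum_congr rfl e2, Finset.sum_add_distrib]
    simp only [Nat.sub_self, ee_d0 x h, Nat.sub_zero, ee_zero x h h0]
    ring

end gen3
end DQ

namespace DQ
section fin

lemma q_ne : q ≠ 0 := by
  unfold q
  rw [Ne, map_eq_zero_iff _ (IsFractionRing.injective (Polynomial ℚ) Fq)]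
  exact Polynomial.X_ne_zero

lemma q_h : ∀ j : ℕ, 0 < j → 1 - q^j ≠ 0 := by
  intro j hj e
  have h1 : q^j = 1 := by linear_combination -e
  unfold q at h1
  rw [← map_pow, ← map_one (algebraMap (Polynomial ℚ) Fq)] at h1
  have h2 := IsFractionRing.injective (Polynomial ℚ) Fq h1
  have h3 := congrArg Polynomial.natDegree h2
  simp at h3
  omega

noncomputable def hom0 : Multiplicative ℤ →* Fq where
  toFun i := q ^ (Multiplicative.toAdd i)
  map_one' := by simp
  map_mul' a b := by simp [zpow_add₀ q_ne]

noncomputable def PosS : Subsemiring Fq :=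
  (AddMonoidAlgebra.lift ℕ Fq ℤ hom0 : AddMonoidAlgebra ℕ ℤ →ₐ[ℕ] Fq).toRingHom.rangeS

lemma mem_PosS {a : Fq} (ha : a ∈ PosS) : ∃ f : ℤ →₀ ℕ, a = f.sum fun i b => (b : Fq) * q ^ i := by
  obtain ⟨f, rfl⟩ := ha
  refine ⟨f.coeff, ?_⟩
  simp [AddMonoidAlgebra.lift_apply, hom0]

lemma zpow_mem (i : ℤ) : q^i ∈ PosS := by
  refine ⟨AddMonoidAlgebra.single i 1, ?_⟩
  change AddMonoidAlgebra.lift ℕ Fq ℤ hom0 (AddMonoidAlgebra.single i 1) = q^i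
  rw [AddMonoidAlgebra.lift_single]
  simp [hom0]

lemma pow_mem' (i : ℕ) : q^i ∈ PosS := by
  have := zpow_mem i
  rwa [zpow_natCast] at this

lemma inv_pow_mem (i : ℕ) : (q^i)⁻¹ ∈ PosS := by
  have := zpow_mem (-i)
  rwa [zpow_neg, zpow_natCast] at this

lemma pascal {F : Type*} [Field F] (x : F) (h : ∀ j : ℕ, 0 < j → 1 - x^j ≠ 0) (n k : ℕ) :
    qBin x (n+1) (k+1) = qBin x n k + x^(k+1) * qBin x n (k+1) := by
  unfold qBin
  rcases lt_trichotomy k n with hk | hk | hk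
  · obtain ⟨d, rfl⟩ : ∃ d, n = k + 1 + d := ⟨n - (k+1), by omega⟩
    rw [if_pos (by omega), if_pos (by omega), if_pos (by omega),
      show k + 1 + d + 1 - (k+1) = d + 1 by omega, show k + 1 + d - (k+1) = d by omega,
      show k + 1 + d - k = d + 1 by omega, qP_succ x k, qP_succ x d, qP_succ x (k+1+d)]
    have h1 := h (k+1) (by omega)
    have h2 := h (d+1) (by omega)
    have h3 := qP_ne x h k
    have h4 := qP_ne x h d
    field_simp
    ring
  · subst hk
    simp [qPoch_zero, qP_ne x h]
  · rw [if_neg (by omega), if_neg (by omega), if_neg (by omega)]; simp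

lemma qBin_mem (n k : ℕ) : qBin q n k ∈ PosS := by
  induction n generalizing k with
  | zero =>
    cases k with
    | zero => simpa [qBin, qPoch_zero] using PosS.one_mem
    | succ k => simpa [qBin] using PosS.zero_mem
  | succ n ih =>
    cases k with
    | zero => simpa [qBin, qPoch_zero, qP_ne q q_h] using PosS.one_mem
    | succ k =>
      rw [pascal q q_h]
      exact PosS.add_mem (ih k) (PosS.mul_mem (pow_mem' _) (ih _))

lemma qBin_add {F : Type*} [Field F] (x : F) (a b : ℕ) :
    qBin x (a+b) a = qPoch x x (a+b) / (qPoch x x a * qPoch x x b) := by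
  unfold qBin; rw [if_pos (by omega), show a + b - a = b by omega]

lemma pp_eval {F : Type*} [Field F] (x : F) (h : ∀ j : ℕ, 0 < j → 1 - x^j ≠ 0) (h0 : x ≠ 0) (l d : ℕ) :
    pp x (x^(l+d)) l = qPoch x x (l+d+l) / qPoch x x d := by
  induction l generalizing d with
  | zero => simp [pp_zero, qP_ne x h]
  | succ l ih =>
    rw [pp_succ, show l + 1 + d = l + (d+1) by ring, ih,
      show l + (d+1) + (l+1) = l + (d+1) + l + 1 by ring, qP_succ x d, qP_succ]
    have h1 := qP_ne x h d
    have h2 := h (d+1) (by omega)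
    have h3 : x^l ≠ 0 := pow_ne_zero _ h0
    have e : x^(l+(d+1)) * (x^l)⁻¹ = x^(d+1) := by rw [pow_add]; field_simp
    rw [e]
    field_simp
    ring

lemma prod_eval {F : Type*} [Field F] (x : F) (h : ∀ j : ℕ, 0 < j → 1 - x^j ≠ 0) (h0 : x ≠ 0) (d c : ℕ) :
    ∏ a ∈ range d, (1 - x^(d+c) * (x^a)⁻¹) = qPoch x x (d+c) / qPoch x x c := by
  induction d generalizing c with
  | zero => simp [qP_ne x h]
  | succ d ih =>
    rw [Finset.prod_range_succ, show d + 1 + c = d + (c+1) by ring, ih, qP_succ x c]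
    have h1 := qP_ne x h c
    have h2 := h (c+1) (by omega)
    have h3 : x^d ≠ 0 := pow_ne_zero _ h0
    have e : x^(d+(c+1)) * (x^d)⁻¹ = x^(c+1) := by rw [pow_add]; field_simp
    rw [e]
    field_simp

lemma ww_eval {F : Type*} [Field F] (x : F) (h : ∀ j : ℕ, 0 < j → 1 - x^j ≠ 0) (l : ℕ) :
    ww x l * qPoch x x (2*l) * qPoch x x l ^ 2 =
      x^(l*l) * ∏ i ∈ range l, ((1 + x^i) * (1 + x * x^i)) := by
  induction l with
  | zero => simp [ww_zero, qPoch_zero]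
  | succ l ih =>
    obtain ⟨h1, h2, h3⟩ := hne x h l
    rw [Finset.prod_range_succ, ww_succ, show 2 * (l+1) = 2*l+1+1 by ring, qP_succ, qP_succ, qP_succ,
      show (1 : F) - x^(2*l+1) = 1 - x * x^l * x^l by ring,
      show (1 : F) - x^(2*l+1+1) = 1 - x * x * x^l * x^l by ring,
      show (1 : F) - x^(l+1) = 1 - x * x^l by ring,
      show x^((l+1)*(l+1)) = x^(l*l) * (x * x^l * x^l) by ring]
    have key : ∀ (A B C N D : F), A ≠ 0 → B ≠ 0 → C ≠ 0 → ∀ w p r : F,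
       w * (N / (A * B * C^2)) * (p * A * B) * (r * C)^2 = (w * p * r^2) * N := by
      intro A B C N D hA hB hC w p r
      field_simp
    rw [key _ _ _ _ 0 h1 h2 h3, ih]
    ring

noncomputable def bb (l k : ℕ) : Fq := ph q (q^k) l / qPoch q q l ^ 2

noncomputable def VV : AddSubmonoid (ℕ → Fq) :=
  AddSubmonoid.closure {g | ∃ a ∈ PosS, ∃ l, g = fun k => a * bb l k}

lemma mem_VV {a : Fq} (ha : a ∈ PosS) (l : ℕ) : (fun k => a * bb l k) ∈ VV :=
  AddSubmonoid.subset_closure ⟨a, ha, l, rfl⟩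

lemma bb_mul (a : Fq) (ha : a ∈ PosS) (i j : ℕ) : (fun k => a * (bb i k * bb j k)) ∈ VV := by
  have e : (fun k => a * (bb i k * bb j k)) = ∑ s ∈ range (j+1),
      fun k => (a * (ee q i s (j-s) * qPoch q q (i+s)^2 / (qPoch q q i ^2 * qPoch q q j^2))) * bb (i+s) k := by
    funext k
    rw [Finset.sum_apply]
    unfold bb
    rw [div_mul_div_comm, ph_mul q _ q_h q_ne (pow_ne_zero _ q_ne), Finset.sum_div, Finset.mul_sum]
    apply Finset.sum_congr rfl
    intro s _
    have h1 := qP_ne q q_h i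
    have h2 := qP_ne q q_h j
    have h3 := qP_ne q q_h (i+s)
    field_simp
  rw [e]
  apply AddSubmonoid.sum_mem
  intro s hs
  rw [Finset.mem_range] at hs
  apply mem_VV
  apply PosS.mul_mem ha
  obtain ⟨d, rfl⟩ : ∃ d, j = s + d := ⟨j - s, by omega⟩
  rw [show s + d - s = d by omega]
  by_cases hd : d ≤ i
  · obtain ⟨c, rfl⟩ : ∃ c, i = d + c := ⟨i - d, by omega⟩
    have e : ee q (d+c) s d * qPoch q q (d+c+s)^2 / (qPoch q q (d+c) ^2 * qPoch q q (s+d)^2) =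
        (q^((d+c+s)*d))⁻¹ * qBin q ((d+c)+(s+d)) (d+c) * qBin q (s+d) s * qBin q ((s+d)+c) (s+d) := by
      unfold ee
      rw [prod_eval q q_h q_ne, qBin_add, qBin_add, qBin_add, show s + d + c = d + c + s by ring,
        show d + c + s + d = d + c + (s + d) by ring]
      have h1 := qP_ne q q_h (d+c)
      have h2 := qP_ne q q_h (s+d)
      have h3 := qP_ne q q_h (d+c+s)
      have h4 := qP_ne q q_h s
      have h5 := qP_ne q q_h d
      have h6 := qP_ne q q_h c
      have h7 : q^((d+c+s)*d) ≠ 0 := pow_ne_zero _ q_ne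
      field_simp
    rw [e]
    exact PosS.mul_mem (PosS.mul_mem (PosS.mul_mem (inv_pow_mem _) (qBin_mem _ _)) (qBin_mem _ _)) (qBin_mem _ _)
  · have e : ee q i s d = 0 := by
      unfold ee
      rw [Finset.prod_eq_zero (i := i) (Finset.mem_range.2 (by omega)), mul_zero]
      rw [mul_inv_cancel₀ (pow_ne_zero _ q_ne), sub_self]
    rw [e]; simp

lemma VV_mul {f g : ℕ → Fq} (hf : f ∈ VV) (hg : g ∈ VV) : f * g ∈ VV := by
  unfold VV at hf
  induction hf using AddSubmonoid.closure_induction with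
  | zero => rw [zero_mul]; exact VV.zero_mem
  | add f1 f2 _ _ h1 h2 => rw [add_mul]; exact VV.add_mem h1 h2
  | mem f hf =>
    obtain ⟨a, ha, i, rfl⟩ := hf
    unfold VV at hg
    induction hg using AddSubmonoid.closure_induction with
    | zero => rw [mul_zero]; exact VV.zero_mem
    | add f1 f2 _ _ h1 h2 => rw [mul_add]; exact VV.add_mem h1 h2
    | mem g hg =>
      obtain ⟨b, hb, j, rfl⟩ := hg
      convert bb_mul (a*b) (PosS.mul_mem ha hb) i j using 1
      funext k
      simp only [Pi.mul_apply]
      ring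

lemma VV_one : (1 : ℕ → Fq) ∈ VV := by
  convert mem_VV PosS.one_mem 0 using 1
  funext k
  simp [bb, ph, pp_zero, qPoch_zero]

lemma VV_pow {f : ℕ → Fq} (hf : f ∈ VV) (r : ℕ) : f^r ∈ VV := by
  induction r with
  | zero => rw [pow_zero]; exact VV_one
  | succ r ih => rw [pow_succ]; exact VV_mul ih hf

lemma DD_mem (m : ℕ) : (fun k => Dq q m k * Dq q⁻¹ m k) ∈ VV := by
  have e : (fun k => Dq q m k * Dq q⁻¹ m k) = ∑ l ∈ range (m+1),
      fun k => (ww q l * qPoch q q l ^2 * ph q (q^m) l) * bb l k := by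
    funext k
    rw [Finset.sum_apply, (main_prod q q_h q_ne k (m+1) m (by omega)).1]
    apply Finset.sum_congr rfl
    intro l _
    have h1 := qP_ne q q_h l
    unfold BB bb ph
    field_simp
  rw [e]
  apply AddSubmonoid.sum_mem
  intro l hl
  rw [Finset.mem_range] at hl
  apply mem_VV
  obtain ⟨d, rfl⟩ : ∃ d, m = l + d := ⟨m - l, by omega⟩
  have e : ww q l * qPoch q q l ^2 * ph q (q^(l+d)) l =
     (q^(l*l) * ∏ i ∈ range l, ((1 + q^i) * (1 + q * q^i))) * (q^((l+d)*l))⁻¹ * qBin q (2*l+d) (2*l) := by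
    rw [← ww_eval q q_h, qBin_add, ph, pp_eval q q_h q_ne, ← pow_mul, show l + d + l = 2*l+d by ring]
    have h1 := qP_ne q q_h (2*l)
    have h2 := qP_ne q q_h d
    field_simp
  rw [e]
  refine PosS.mul_mem (PosS.mul_mem (PosS.mul_mem (pow_mem' _) (PosS.prod_mem ?_)) (inv_pow_mem _)) (qBin_mem _ _)
  intro i _
  refine PosS.mul_mem (PosS.add_mem PosS.one_mem (pow_mem' _)) (PosS.add_mem PosS.one_mem ?_)
  rw [← pow_succ']
  exact pow_mem' _

lemma alt_sum (l n : ℕ) :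
    ∑ k ∈ range n, (-1 : Fq)^(n-k-1) * (1 - q^(2*k+1)) * bb l k * q^(k*(k-1)/2) =
      q^(n*(n-1)/2) * (1 - q^n * (q^l)⁻¹) * bb l n := by
  induction n with
  | zero =>
    cases l with
    | zero => simp
    | succ l =>
      have : bb (l+1) 0 = 0 := by
        unfold bb ph; rw [pp_vanish q q_ne 0 (l+1) (by omega)]; simp
      rw [this]; simp
  | succ n ih =>
    have e : ∀ k ∈ range n, (-1 : Fq)^(n+1-k-1) * (1 - q^(2*k+1)) * bb l k * q^(k*(k-1)/2) =
       (-1) * ((-1 : Fq)^(n-k-1) * (1 - q^(2*k+1)) * bb l k * q^(k*(k-1)/2)) := by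
      intro k hk
      rw [Finset.mem_range] at hk
      rw [show n + 1 - k - 1 = (n-k-1) + 1 by omega, pow_succ]
      ring
    rw [Finset.sum_range_succ, Finset.sum_congr rfl e, ← Finset.mul_sum, ih, tri_succ,
      show n + 1 - n - 1 = 0 by omega]
    have hb : (1 - q^(n+1) * (q^l)⁻¹) * bb l (n+1) = (q^l)⁻¹ * (1 - q^n * q^(l+1)) * bb l n := by
      unfold bb ph
      have := pp_up' q (q^n) q_ne l
      rw [← pow_succ] at this
      have h1 := qP_ne q q_h l
      have h2 : q^n ≠ 0 := pow_ne_zero _ q_ne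
      have h3 : q^l ≠ 0 := pow_ne_zero _ q_ne
      have h4 := q_ne
      have e5 : (q^(n+1))^l = (q^n)^l * q^l := by rw [pow_succ, mul_pow]
      rw [e5]
      have h6 : (q^n)^l ≠ 0 := pow_ne_zero _ h2
      generalize (q^n)^l = t at *
      trans (pp q (q ^ (n + 1)) l * (1 - q ^ (n + 1) * (q ^ l)⁻¹)) * (t * q^l * qPoch q q l^2)⁻¹
      · field_simp
      · rw [this]; field_simp
    rw [mul_assoc (q^(_+_)), hb, pow_add]
    have h3 : q^l ≠ 0 := pow_ne_zero _ q_ne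
    field_simp
    ring

lemma final_term (a : Fq) (ha : a ∈ PosS) (l n : ℕ) (hn : 0 < n) :
    a * (q^(n*(n-1)/2) * (1 - q^n * (q^l)⁻¹) * bb l n / (1 - q^n)) ∈ PosS := by
  apply PosS.mul_mem ha
  rcases lt_trichotomy l n with h | h | h
  · obtain ⟨d, rfl⟩ : ∃ d, n = l + (d + 1) := ⟨n - l - 1, by omega⟩
    have e : q^((l+(d+1))*((l+(d+1))-1)/2) * (1 - q^(l+(d+1)) * (q^l)⁻¹) * bb l (l+(d+1)) / (1 - q^(l+(d+1)))
      = q^((l+(d+1))*((l+(d+1))-1)/2) * (q^((l+(d+1))*l))⁻¹ * qBin q (l+(l+(d+1))) l * qBin q (l+d) l := by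
      rw [qBin_add, qBin_add, bb, ph, pp_eval q q_h q_ne, ← pow_mul, qP_succ q d,
        show l + (d+1) + l = l + (l + (d+1)) by ring]
      have h3 : q^l ≠ 0 := pow_ne_zero _ q_ne
      have e : q^(l+(d+1)) * (q^l)⁻¹ = q^(d+1) := by rw [pow_add]; field_simp
      rw [e, show qPoch q q (l + (d+1)) = qPoch q q (l+d) * (1 - q^(l+(d+1))) from qP_succ q (l+d)]
      have h1 := qP_ne q q_h l
      have h2 := qP_ne q q_h d
      have h4 := qP_ne q q_h (l+d)
      have h5 := q_h (d+1) (by omega)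
      have h6 := q_h (l+(d+1)) (by omega)
      field_simp
    rw [e]
    exact PosS.mul_mem (PosS.mul_mem (PosS.mul_mem (pow_mem' _) (inv_pow_mem _)) (qBin_mem _ _)) (qBin_mem _ _)
  · subst h
    rw [mul_inv_cancel₀ (pow_ne_zero _ q_ne)]; simp
  · unfold bb ph
    rw [pp_vanish q q_ne n l h]; simp

lemma VV_sum {g : ℕ → Fq} (hg : g ∈ VV) (n : ℕ) (hn : 0 < n) :
    ∑ k ∈ range n, (-1 : Fq)^(n-k-1) * ((1 - q^(2*k+1)) / (1 - q^n)) * g k * q^(k*(k-1)/2) ∈ PosS := by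
  unfold VV at hg
  induction hg using AddSubmonoid.closure_induction with
  | zero => simp
  | add f1 f2 _ _ h1 h2 =>
    convert PosS.add_mem h1 h2 using 1
    rw [← Finset.sum_add_distrib]
    apply Finset.sum_congr rfl
    intro k _
    rw [Pi.add_apply]; ring
  | mem g hg =>
    obtain ⟨a, ha, l, rfl⟩ := hg
    convert final_term a ha l n hn using 1
    rw [← alt_sum, Finset.sum_div, Finset.mul_sum]
    apply Finset.sum_congr rfl
    intro k _
    ring

end fin
end DQ

theorem Dq_pow_alt_sum_nonneg_coeffs (m n r : ℕ) (hm : 0 < m) (hn : 0 < n) (hr : 0 < r) :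
    ∃ f : ℤ →₀ ℕ,
      ∑ k ∈ Finset.range n,
          (-1 : Fq) ^ (n - k - 1) * ((1 - q ^ (2 * k + 1)) / (1 - q ^ n)) *
            Dq q m k ^ r * Dq q⁻¹ m k ^ r * q ^ (k * (k - 1) / 2) =
      f.sum fun i b => (b : Fq) * q ^ i := by
  apply DQ.mem_PosS
  convert DQ.VV_sum (DQ.VV_pow (DQ.DD_mem m) r) n hn using 1
  apply Finset.sum_congr rfl
  intro k _
  rw [Pi.pow_apply, mul_pow]
  ring
end
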